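/- arXiv:2001.09850 — 3 statements merged into one kernel-verified Lean document; each statement's English description precedes it below -/
import Mathlib

section
/- Let u, v > 0. (i) If u/v > 1, then I(u,v) = b·(b − 4γ/(γ+1) + 4γ/(e^b + γ)), where b > 0 is the unique positive solution of sinh(b/2)/(b/2) = u/v and γ := e^{b/2}·(v·e^{b/2} − 1)/(e^{b/2} − v) (assuming v ≠ e^{b/2}, γ ≠ −1 and e^b + γ ≠ 0 so that all expressions are defined). (ii) If u/v < 1, then I(u,v) = 4λ²·(u/cos²η − 1), where λ ∈ (0, π) is the unique solution of sin λ/λ = u/v and η ∈ (−π/2, π/2) is determined by tan η = (v·cos λ − 1)/(v·sin λ). (iii) If u = v, then I(u,u) = 4(u−1)²/u. -/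
open MeasureTheory ProbabilityTheory Filter Real

/-- The variational rate function `I(u,v)`: infimum of `4∫₀¹ f'(z)² dz` over absolutely
continuous `f : [0,1] → ℝ` (written as `f(z) = ∫₀ᶻ g`) with square-integrable derivative `g`,
`f(0) = 0`, `∫₀¹ e^{2 f(z)} dz = u` and `e^{f(1)} = v`. -/
noncomputable def ratefun (u v : ℝ) : ℝ :=
  sInf {r : ℝ | ∃ g : ℝ → ℝ,
    IntervalIntegrable g volume 0 1 ∧
    IntervalIntegrable (fun z => (g z) ^ 2) volume 0 1 ∧
    (∫ z in (0:ℝ)..(1:ℝ), Real.exp (2 * ∫ t in (0:ℝ)..z, g t)) = u ∧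
    Real.exp (∫ t in (0:ℝ)..(1:ℝ), g t) = v ∧
    r = 4 * ∫ z in (0:ℝ)..(1:ℝ), (g z) ^ 2}

open Set in
/-- Postcomposition with a Lipschitz function preserves absolute continuity. -/
theorem AbsolutelyContinuousOnInterval.lipschitzOnWith_comp {f φ : ℝ → ℝ} {a b : ℝ} {s : Set ℝ}
    {K : NNReal} (hφ : LipschitzOnWith K φ s) (hf : AbsolutelyContinuousOnInterval f a b)
    (hm : MapsTo f (uIcc a b) s) : AbsolutelyContinuousOnInterval (fun x => φ (f x)) a b := by
  rw [absolutelyContinuousOnInterval_iff] at hf ⊢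
  intro ε hε
  obtain ⟨δ, hδ, h⟩ := hf (ε / (K + 1)) (by positivity)
  refine ⟨δ, hδ, fun E hE hlt => ?_⟩
  have hK : (0 : ℝ) < K + 1 := by positivity
  calc ∑ i ∈ Finset.range E.1, dist (φ (f (E.2 i).1)) (φ (f (E.2 i).2))
      ≤ ∑ i ∈ Finset.range E.1, (K + 1 : ℝ) * dist (f (E.2 i).1) (f (E.2 i).2) := by
        refine Finset.sum_le_sum fun i hi => ?_
        have hi' := hE.1 i hi
        refine (hφ.dist_le_mul _ (hm hi'.1) _ (hm hi'.2)).trans ?_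
        gcongr
        linarith
    _ = (K + 1 : ℝ) * ∑ i ∈ Finset.range E.1, dist (f (E.2 i).1) (f (E.2 i).2) := by
        rw [Finset.mul_sum]
    _ < (K + 1 : ℝ) * (ε / (K + 1)) := by gcongr; exact h E hE hlt
    _ = ε := by field_simp

open Set in
/-- Postcomposition with a `C¹` function preserves absolute continuity. -/
theorem AbsolutelyContinuousOnInterval.contDiffOn_comp {f φ : ℝ → ℝ} {a b c d : ℝ}
    (hφ : ContDiffOn ℝ 1 φ (Icc c d)) (hf : AbsolutelyContinuousOnInterval f a b)
    (hm : MapsTo f (uIcc a b) (Icc c d)) :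
    AbsolutelyContinuousOnInterval (fun x => φ (f x)) a b := by
  obtain ⟨K, hK⟩ := hφ.exists_lipschitzOnWith (by decide) (convex_Icc _ _) isCompact_Icc
  exact hf.lipschitzOnWith_comp hK hm

theorem absolutelyContinuousOnInterval_primitive {g : ℝ → ℝ}
    (hg : IntervalIntegrable g volume 0 1) :
    AbsolutelyContinuousOnInterval (fun z => ∫ t in (0:ℝ)..z, g t) 0 1 :=
  hg.absolutelyContinuousOnInterval_intervalIntegral (by simp)

theorem ae_mem_Ioo_of_mem_uIcc : ∀ᵐ z : ℝ, z ∈ Set.uIcc (0:ℝ) 1 → z ∈ Set.Ioo (0:ℝ) 1 := by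
  have h0 : ∀ᵐ z : ℝ, z ≠ 0 := by simp [ae_iff, measure_singleton]
  have h1 : ∀ᵐ z : ℝ, z ≠ 1 := by simp [ae_iff, measure_singleton]
  filter_upwards [h0, h1] with z hz0 hz1 hz
  rw [Set.uIcc_of_le zero_le_one] at hz
  exact ⟨lt_of_le_of_ne hz.1 (Ne.symm hz0), lt_of_le_of_ne hz.2 hz1⟩

/-- Fundamental theorem of calculus for `exp f * p`, where `f` is a primitive of an integrable
function and `p` is absolutely continuous. -/
theorem integral_exp_primitive_mul {g p p' : ℝ → ℝ} (hg : IntervalIntegrable g volume 0 1)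
    (hp : AbsolutelyContinuousOnInterval p 0 1)
    (hp' : ∀ z ∈ Set.Ioo (0:ℝ) 1, HasDerivAt p (p' z) z) :
    IntervalIntegrable
      (fun z => exp (∫ t in (0:ℝ)..z, g t) * (g z * p z + p' z)) volume 0 1 ∧
    ∫ z in (0:ℝ)..1, exp (∫ t in (0:ℝ)..z, g t) * (g z * p z + p' z) =
      exp (∫ t in (0:ℝ)..1, g t) * p 1 - p 0 := by
  have hf := absolutelyContinuousOnInterval_primitive hg
  obtain ⟨M, hM⟩ := hf.exists_bound
  have hexp := hf.contDiffOn_comp (c := -M) (d := M) Real.contDiff_exp.contDiffOn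
    fun z hz => abs_le.mp (hM z hz)
  have hF := hexp.fun_mul hp
  have hae : ∀ᵐ z : ℝ, z ∈ Set.uIoc (0:ℝ) 1 →
      deriv (fun z => exp (∫ t in (0:ℝ)..z, g t) * p z) z =
        exp (∫ t in (0:ℝ)..z, g t) * (g z * p z + p' z) := by
    filter_upwards [hg.ae_hasDerivAt_integral, ae_mem_Ioo_of_mem_uIcc] with z hz hz' hmem
    have hmem' := Set.uIoc_subset_uIcc hmem
    have := ((hz hmem' 0 (by simp)).exp.mul (hp' z (hz' hmem'))).deriv
    rw [show (fun z => exp (∫ t in (0:ℝ)..z, g t) * p z) =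
      (fun z => exp (∫ t in (0:ℝ)..z, g t)) * p from rfl, this]
    ring
  constructor
  · refine hF.intervalIntegrable_deriv.congr_ae ?_
    rw [Filter.EventuallyEq, ae_restrict_iff' measurableSet_uIoc]
    exact hae
  · rw [← intervalIntegral.integral_congr_ae hae, hF.integral_deriv_eq_sub]
    simp

/-- A calibration `p` together with a remainder `ρ` bounds the energy from below. -/
theorem le_integral_sq_of_calibration {g p p' ρ : ℝ → ℝ}
    (hg : IntervalIntegrable g volume 0 1)
    (hg2 : IntervalIntegrable (fun z => g z ^ 2) volume 0 1)
    (hp : AbsolutelyContinuousOnInterval p 0 1)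
    (hp' : ∀ z ∈ Set.Ioo (0:ℝ) 1, HasDerivAt p (p' z) z)
    (hρ : IntervalIntegrable ρ volume 0 1)
    (hle : ∀ z ∈ Set.Icc (0:ℝ) 1, ∀ x : ℝ,
      exp (∫ t in (0:ℝ)..z, g t) * (x * p z + p' z) + ρ z ≤ x ^ 2) :
    exp (∫ t in (0:ℝ)..1, g t) * p 1 - p 0 + ∫ z in (0:ℝ)..1, ρ z ≤
      ∫ z in (0:ℝ)..1, g z ^ 2 := by
  obtain ⟨hi, he⟩ := integral_exp_primitive_mul hg hp hp'
  rw [← he, ← intervalIntegral.integral_add hi hρ]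
  exact intervalIntegral.integral_mono_on zero_le_one (hi.add hρ) hg2 fun z hz => hle z hz (g z)

theorem continuousOn_exp_two_mul_primitive {g : ℝ → ℝ} (hg : IntervalIntegrable g volume 0 1) :
    ContinuousOn (fun z => exp (2 * ∫ t in (0:ℝ)..z, g t)) (Set.uIcc 0 1) :=
  ((absolutelyContinuousOnInterval_primitive hg).continuousOn.const_mul 2).rexp

/-- Lower bound for the energy in the trigonometric regime. -/
theorem trig_lower_bound {g : ℝ → ℝ} {u v l h : ℝ}
    (hg : IntervalIntegrable g volume 0 1)
    (hg2 : IntervalIntegrable (fun z => g z ^ 2) volume 0 1)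
    (hu : (∫ z in (0:ℝ)..1, exp (2 * ∫ t in (0:ℝ)..z, g t)) = u)
    (hv : exp (∫ t in (0:ℝ)..1, g t) = v)
    (hcos : v * cos l = 1 + h * u) (hsin : v * sin l = l * u) :
    -l ^ 2 + (l ^ 2 + h ^ 2) * u ≤ ∫ z in (0:ℝ)..1, g z ^ 2 := by
  have hc := (continuousOn_exp_two_mul_primitive hg).intervalIntegrable (μ := volume)
  have hd : ∀ z : ℝ, HasDerivAt (fun z => 2 * (h * cos (l * z) + l * sin (l * z)))
      (2 * l * (l * cos (l * z) - h * sin (l * z))) z := by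
    intro z
    have hl : HasDerivAt (fun z : ℝ => l * z) l z := by
      simpa using (hasDerivAt_id z).const_mul l
    convert! ((hl.cos.const_mul h).add (hl.sin.const_mul l)).const_mul 2 using 1
    ring
  have key := le_integral_sq_of_calibration (p := fun z => 2 * (h * cos (l * z) + l * sin (l * z)))
    (p' := fun z => 2 * l * (l * cos (l * z) - h * sin (l * z)))
    (ρ := fun z => -l ^ 2 - (l ^ 2 + h ^ 2) * exp (2 * ∫ t in (0:ℝ)..z, g t)) hg hg2
    (ContDiffOn.absolutelyContinuousOnInterval (by fun_prop)) (fun z _ => hd z)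
    (by simpa using (intervalIntegrable_const (c := -l ^ 2)).sub (hc.const_mul (l ^ 2 + h ^ 2))) ?_
  · rw [intervalIntegral.integral_sub (by simp) (hc.const_mul _),
      intervalIntegral.integral_const_mul, hu, hv] at key
    simp only [mul_one, mul_zero, cos_zero, sin_zero, intervalIntegral.integral_const, sub_zero,
      smul_eq_mul, one_mul, add_zero] at key
    linear_combination key - 2 * h * hcos - 2 * l * hsin
  · intro z _ x
    have e : exp (2 * ∫ t in (0:ℝ)..z, g t) = exp (∫ t in (0:ℝ)..z, g t) ^ 2 := by
      rw [← Real.exp_nat_mul]; norm_num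
    simp only [e]
    generalize exp (∫ t in (0:ℝ)..z, g t) = w
    have h1 := sin_sq_add_cos_sq (l * z)
    generalize sin (l * z) = s at *
    generalize cos (l * z) = c at *
    have h2 := sq_nonneg (x - w * (h * c + l * s))
    have h3 := sq_nonneg (l - w * (l * c - h * s))
    linear_combination h2 + h3 + w ^ 2 * (l ^ 2 + h ^ 2) * h1

/-- Lower bound for the energy in the hyperbolic (or, for `β = 0`, affine) regime. -/
theorem hyperbolic_lower_bound {g : ℝ → ℝ} {u v β h : ℝ}
    (hg : IntervalIntegrable g volume 0 1)
    (hg2 : IntervalIntegrable (fun z => g z ^ 2) volume 0 1)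
    (hu : (∫ z in (0:ℝ)..1, exp (2 * ∫ t in (0:ℝ)..z, g t)) = u)
    (hv : exp (∫ t in (0:ℝ)..1, g t) = v)
    (hplus : 1 + (h + β) * u = v * exp β) (hminus : 1 + (h - β) * u = v * exp (-β)) :
    β ^ 2 - (β ^ 2 - h ^ 2) * u ≤ ∫ z in (0:ℝ)..1, g z ^ 2 := by
  have hv0 : 0 < v := hv ▸ exp_pos _
  have hc := continuousOn_exp_two_mul_primitive hg
  have hci := hc.intervalIntegrable (μ := volume)
  set τ : ℝ → ℝ := fun z => ∫ s in (0:ℝ)..z, exp (2 * ∫ t in (0:ℝ)..s, g t) with hτ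
  have hτac : AbsolutelyContinuousOnInterval τ 0 1 := absolutelyContinuousOnInterval_primitive hci
  have hτd : ∀ z ∈ Set.Ioo (0:ℝ) 1, HasDerivAt τ (exp (2 * ∫ t in (0:ℝ)..z, g t)) z := by
    intro z hz
    have hsub : Set.uIcc 0 z ⊆ Set.uIcc (0:ℝ) 1 := by
      rw [Set.uIcc_of_le hz.1.le, Set.uIcc_of_le zero_le_one]
      exact Set.Icc_subset_Icc_right hz.2.le
    have hnhds : Set.uIcc (0:ℝ) 1 ∈ nhds z := by
      rw [Set.uIcc_of_le zero_le_one]; exact Icc_mem_nhds hz.1 hz.2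
    refine intervalIntegral.integral_hasDerivAt_right (hc.mono hsub).intervalIntegrable
      (ContinuousOn.stronglyMeasurableAtFilter isOpen_Ioo (hc.mono ?_) z hz) (hc.continuousAt hnhds)
    rw [Set.uIcc_of_le zero_le_one]
    exact Set.Ioo_subset_Icc_self
  have hτ0 : τ 0 = 0 := by simp [hτ]
  have hτ1 : τ 1 = u := hu
  have hτmono : ∀ z ∈ Set.Icc (0:ℝ) 1, τ z ∈ Set.Icc 0 u := by
    have hm : MonotoneOn τ (Set.Icc 0 1) := by
      refine monotoneOn_of_deriv_nonneg (convex_Icc 0 1) ?_ ?_ ?_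
      · simpa using hτac.continuousOn
      · rw [interior_Icc]
        exact fun z hz => (hτd z hz).differentiableAt.differentiableWithinAt
      · rw [interior_Icc]
        exact fun z hz => (hτd z hz).deriv ▸ (exp_pos _).le
    intro z hz
    rw [← hτ0, ← hτ1]
    exact ⟨hm (by simp) hz hz.1, hm hz (by simp) hz.2⟩
  have hlin : ∀ a : ℝ, 0 < 1 + a * u → ∀ t ∈ Set.Icc 0 u, 0 < 1 + a * t := by
    intro a ha t ht
    rcases le_or_gt 0 a with h0 | h0
    · have := mul_nonneg h0 ht.1
      linarith
    · nlinarith [ht.2]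
  have hLp := hlin (h + β) (hplus ▸ by positivity)
  have hLm := hlin (h - β) (hminus ▸ by positivity)
  set Q : ℝ → ℝ := fun t => (1 + (h + β) * t) * (1 + (h - β) * t) with hQ
  have hQpos : ∀ t ∈ Set.Icc 0 u, 0 < Q t := fun t ht => mul_pos (hLp t ht) (hLm t ht)
  have hQu : √(Q u) = v := by
    have : Q u = v ^ 2 := by
      simp only [hQ, hplus, hminus]
      rw [show v * exp β * (v * exp (-β)) = v ^ 2 * exp (β + -β) by rw [exp_add]; ring]
      simp
    rw [this, sqrt_sq hv0.le]
  have hLd : ∀ a t : ℝ, HasDerivAt (fun t => 1 + a * t) a t := fun a t => by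
    simpa using ((hasDerivAt_id t).const_mul a).const_add 1
  set κ := β ^ 2 - h ^ 2 with hκ
  have hqd : ∀ t ∈ Set.Icc 0 u,
      HasDerivAt (fun t => 2 * ((h - κ * t) / √(Q t))) (-2 * β ^ 2 / √(Q t) ^ 3) t := by
    intro t ht
    have hs : 0 < √(Q t) := sqrt_pos.2 (hQpos t ht)
    have hs2 : √(Q t) ^ 2 = Q t := sq_sqrt (hQpos t ht).le
    have hQd := ((hLd (h + β) t).mul (hLd (h - β) t)).sqrt (hQpos t ht).ne'
    have hn : HasDerivAt (fun t => h - κ * t) (-κ) t := by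
      simpa using ((hasDerivAt_id t).const_mul κ).const_sub h
    convert! (hn.div hQd hs.ne').const_mul 2 using 1
    change _ = 2 * ((-κ * √(Q t) - (h - κ * t) *
      (((h + β) * (1 + (h - β) * t) + (1 + (h + β) * t) * (h - β)) / (2 * √(Q t)))) / √(Q t) ^ 2)
    have hs2' : √(Q t) ^ 2 = (1 + (h + β) * t) * (1 + (h - β) * t) := hs2
    field_simp
    rw [hs2', hκ]
    ring
  have hGd : ∀ t ∈ Set.Icc 0 u,
      HasDerivAt (fun t => β * (log (1 + (h + β) * t) - log (1 + (h - β) * t)) + κ * t)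
        (2 * β ^ 2 / Q t + κ) t := by
    intro t ht
    have h1 := hLp t ht
    have h2 := hLm t ht
    convert! ((((hLd (h + β) t).log h1.ne').sub ((hLd (h - β) t).log h2.ne')).const_mul β).add
      ((hasDerivAt_id t).const_mul κ) using 1
    rw [div_sub_div _ _ h1.ne' h2.ne', ← mul_div_assoc, mul_one]
    congr 2
    ring
  have hQτ : ContinuousOn (fun z => Q (τ z)) (Set.Icc 0 1) := by
    have : ContinuousOn τ (Set.Icc 0 1) := by simpa using hτac.continuousOn
    simp only [hQ]
    fun_prop
  have hρc : ContinuousOn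
      (fun z => (2 * β ^ 2 / Q (τ z) + κ) * exp (2 * ∫ t in (0:ℝ)..z, g t)) (Set.uIcc 0 1) := by
    refine ContinuousOn.mul (ContinuousOn.add (ContinuousOn.div continuousOn_const ?_ ?_)
      continuousOn_const) hc
    · simpa using hQτ
    · rw [Set.uIcc_of_le zero_le_one]
      exact fun z hz => (hQpos _ (hτmono z hz)).ne'
  have hρi := hρc.intervalIntegrable (μ := volume)
  have hρ : ∫ z in (0:ℝ)..1, (2 * β ^ 2 / Q (τ z) + κ) * exp (2 * ∫ t in (0:ℝ)..z, g t) =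
      2 * β ^ 2 + κ * u := by
    rw [intervalIntegral.integral_eq_sub_of_hasDerivAt_of_le zero_le_one
      (f := fun z => β * (log (1 + (h + β) * τ z) - log (1 + (h - β) * τ z)) + κ * τ z)
      ?_ (fun z hz => (hGd _ (hτmono z (Set.Ioo_subset_Icc_self hz))).comp z (hτd z hz)) hρi]
    · simp only [hτ0, hτ1, hplus, hminus]
      rw [log_mul hv0.ne' (exp_pos _).ne', log_mul hv0.ne' (exp_pos _).ne', log_exp, log_exp]
      simp
      ring
    · have : ContinuousOn τ (Set.Icc 0 1) := by simpa using hτac.continuousOn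
      intro z hz
      exact (hGd _ (hτmono z hz)).continuousAt.comp_continuousWithinAt (this z hz)
  have hpac : AbsolutelyContinuousOnInterval (fun z => 2 * ((h - κ * τ z) / √(Q (τ z)))) 0 1 := by
    refine hτac.contDiffOn_comp (φ := fun t => 2 * ((h - κ * t) / √(Q t))) (c := 0) (d := u) ?_
      (by rw [Set.uIcc_of_le zero_le_one]; exact hτmono)
    refine contDiffOn_const.mul (ContDiffOn.div (by fun_prop) (ContDiffOn.sqrt ?_ ?_) ?_)
    · simp only [hQ]; fun_prop
    · exact fun t ht => (hQpos t ht).ne'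
    · exact fun t ht => (sqrt_pos.2 (hQpos t ht)).ne'
  have key := le_integral_sq_of_calibration
    (p := fun z => 2 * ((h - κ * τ z) / √(Q (τ z))))
    (p' := fun z => -2 * β ^ 2 / √(Q (τ z)) ^ 3 * exp (2 * ∫ t in (0:ℝ)..z, g t))
    (ρ := fun z => (2 * β ^ 2 / Q (τ z) + κ) * exp (2 * ∫ t in (0:ℝ)..z, g t) - β ^ 2) hg hg2
    hpac (fun z hz => (hqd _ (hτmono z (Set.Ioo_subset_Icc_self hz))).comp z (hτd z hz))
    (hρi.sub (by simp)) ?_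
  · rw [intervalIntegral.integral_sub hρi (by simp), hρ, hv] at key
    have hQ0 : Q 0 = 1 := by simp [hQ]
    simp only [hτ0, hτ1, hQu, hQ0, sqrt_one, intervalIntegral.integral_const, sub_zero,
      smul_eq_mul, one_mul, mul_zero, div_one] at key
    have e : v * (2 * ((h - κ * u) / v)) = 2 * (h - κ * u) := by field_simp
    rw [e] at key
    linarith
  · intro z hz x
    have e : exp (2 * ∫ t in (0:ℝ)..z, g t) = exp (∫ t in (0:ℝ)..z, g t) ^ 2 := by
      rw [← Real.exp_nat_mul]; norm_num
    have hw := exp_pos (∫ t in (0:ℝ)..z, g t)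
    simp only [e]
    generalize exp (∫ t in (0:ℝ)..z, g t) = w at *
    have hs : 0 < √(Q (τ z)) := sqrt_pos.2 (hQpos _ (hτmono z hz))
    have hs2 : Q (τ z) = √(Q (τ z)) ^ 2 := (sq_sqrt (hQpos _ (hτmono z hz)).le).symm
    have hq : (h - κ * τ z) ^ 2 = β ^ 2 - κ * √(Q (τ z)) ^ 2 := by
      rw [← hs2]; simp only [hQ, hκ]; ring
    rw [hs2]
    rw [sqrt_sq hs.le]
    generalize √(Q (τ z)) = s at *
    generalize h - κ * τ z = n at *
    have h1 := sq_nonneg (x - w * (n / s))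
    have h2 : 0 ≤ β ^ 2 * ((1 - w / s) ^ 2 * (1 + 2 * (w / s))) := by positivity
    have h3 : (n / s) ^ 2 = β ^ 2 / s ^ 2 - κ := by
      rw [div_pow, hq]; field_simp
    have h4 : x ^ 2 - (w * (x * (2 * (n / s)) + -2 * β ^ 2 / s ^ 3 * w ^ 2) +
        ((2 * β ^ 2 / s ^ 2 + κ) * w ^ 2 - β ^ 2)) =
        (x - w * (n / s)) ^ 2 + β ^ 2 * ((1 - w / s) ^ 2 * (1 + 2 * (w / s))) -
          w ^ 2 * ((n / s) ^ 2 - (β ^ 2 / s ^ 2 - κ)) := by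
      field_simp
      ring
    rw [h3, sub_self, mul_zero, sub_zero] at h4
    linarith

/-- The energy `E - κ u` is attained by `f = -log y`, where `y` satisfies the energy identity
`y'² = E y² - κ` and `S` is a companion solution with unit Wronskian. -/
theorem exists_admissible {y y' S S' : ℝ → ℝ} {E κ u v : ℝ} (hv : 0 < v)
    (hy : ∀ z, HasDerivAt y (y' z) z) (hy'c : Continuous y')
    (hpos : ∀ z ∈ Set.Icc (0:ℝ) 1, 0 < y z)
    (hy0 : y 0 = 1) (hy1 : y 1 = 1 / v) (hen : ∀ z, y' z ^ 2 = E * y z ^ 2 - κ)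
    (hS : ∀ z, HasDerivAt S (S' z) z) (hS0 : S 0 = 0) (hS1 : S 1 * v = u)
    (hW : ∀ z, S' z * y z - S z * y' z = 1) :
    ∃ g : ℝ → ℝ,
      IntervalIntegrable g volume 0 1 ∧
      IntervalIntegrable (fun z => (g z) ^ 2) volume 0 1 ∧
      (∫ z in (0:ℝ)..(1:ℝ), Real.exp (2 * ∫ t in (0:ℝ)..z, g t)) = u ∧
      Real.exp (∫ t in (0:ℝ)..(1:ℝ), g t) = v ∧
      4 * (E - κ * u) = 4 * ∫ z in (0:ℝ)..(1:ℝ), (g z) ^ 2 := by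
  have hyc : Continuous y := continuous_iff_continuousAt.2 fun z => (hy z).continuousAt
  have hne : ∀ z ∈ Set.uIcc (0:ℝ) 1, y z ≠ 0 := by
    rw [Set.uIcc_of_le zero_le_one]; exact fun z hz => (hpos z hz).ne'
  have hgc : ContinuousOn (fun z => -(y' z / y z)) (Set.uIcc 0 1) :=
    (hy'c.continuousOn.div hyc.continuousOn hne).neg
  have hprim : ∀ z ∈ Set.Icc (0:ℝ) 1, ∫ t in (0:ℝ)..z, -(y' t / y t) = -log (y z) := by
    intro z hz
    have hsub : Set.uIcc 0 z ⊆ Set.uIcc (0:ℝ) 1 := by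
      rw [Set.uIcc_of_le hz.1, Set.uIcc_of_le zero_le_one]
      exact Set.Icc_subset_Icc_right hz.2
    rw [intervalIntegral.integral_eq_sub_of_hasDerivAt (f := fun t => -log (y t))
      (fun t ht => ((hy t).log (hne t (hsub ht))).neg) (hgc.mono hsub).intervalIntegrable]
    simp [hy0]
  have hinv : ContinuousOn (fun z => 1 / y z ^ 2) (Set.uIcc 0 1) :=
    continuousOn_const.div (hyc.continuousOn.pow 2) fun z hz => pow_ne_zero 2 (hne z hz)
  have hint : ∫ z in (0:ℝ)..1, 1 / y z ^ 2 = u := by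
    rw [intervalIntegral.integral_eq_sub_of_hasDerivAt (f := fun z => S z / y z) ?_
      hinv.intervalIntegrable]
    · rw [hS0, hy1, zero_div, sub_zero, div_div_eq_mul_div, div_one, hS1]
    · intro z hz
      rw [← hW z]
      exact (hS z).div (hy z) (hne z hz)
  refine ⟨fun z => -(y' z / y z), hgc.intervalIntegrable, (hgc.pow 2).intervalIntegrable,
    ?_, ?_, ?_⟩
  · rw [← hint]
    refine intervalIntegral.integral_congr fun z hz => ?_
    rw [Set.uIcc_of_le zero_le_one] at hz
    simp only [hprim z hz]
    rw [show 2 * -log (y z) = -(2 * log (y z)) by ring, exp_neg,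
      show 2 * log (y z) = ((2 : ℕ) : ℝ) * log (y z) by norm_num, exp_nat_mul,
      exp_log (hpos z hz), one_div]
  · rw [hprim 1 (by simp), hy1]
    simp [exp_log hv]
  · have hsq : ∫ z in (0:ℝ)..1, (-(y' z / y z)) ^ 2 = ∫ z in (0:ℝ)..1, (E - κ * (1 / y z ^ 2)) := by
      refine intervalIntegral.integral_congr fun z hz => ?_
      have := hne z hz
      simp only [neg_sq, div_pow, hen]
      field_simp
    rw [hsq, intervalIntegral.integral_sub (by simp) (hinv.intervalIntegrable.const_mul κ),
      intervalIntegral.integral_const_mul, hint]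
    simp

theorem ratefun_eq_of_isLeast {u v r : ℝ}
    (hex : ∃ g : ℝ → ℝ,
      IntervalIntegrable g volume 0 1 ∧
      IntervalIntegrable (fun z => (g z) ^ 2) volume 0 1 ∧
      (∫ z in (0:ℝ)..(1:ℝ), Real.exp (2 * ∫ t in (0:ℝ)..z, g t)) = u ∧
      Real.exp (∫ t in (0:ℝ)..(1:ℝ), g t) = v ∧
      4 * r = 4 * ∫ z in (0:ℝ)..(1:ℝ), (g z) ^ 2)
    (hle : ∀ g : ℝ → ℝ, IntervalIntegrable g volume 0 1 →
      IntervalIntegrable (fun z => (g z) ^ 2) volume 0 1 →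
      (∫ z in (0:ℝ)..(1:ℝ), Real.exp (2 * ∫ t in (0:ℝ)..z, g t)) = u →
      Real.exp (∫ t in (0:ℝ)..(1:ℝ), g t) = v → r ≤ ∫ z in (0:ℝ)..(1:ℝ), (g z) ^ 2) :
    ratefun u v = 4 * r := by
  refine IsLeast.csInf_eq ⟨hex, ?_⟩
  rintro _ ⟨g, h1, h2, h3, h4, rfl⟩
  linarith [hle g h1 h2 h3 h4]

theorem ratefun_trig {u v l h : ℝ} (hv : 0 < v) (hl : l ∈ Set.Ioo 0 π)
    (hcos : v * cos l = 1 + h * u) (hsin : v * sin l = l * u) :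
    ratefun u v = 4 * (-l ^ 2 + (l ^ 2 + h ^ 2) * u) := by
  have hl0 := hl.1
  have hs : 0 < sin l := sin_pos_of_mem_Ioo hl
  refine ratefun_eq_of_isLeast ?_ fun g h1 h2 h3 h4 => trig_lower_bound h1 h2 h3 h4 hcos hsin
  have hd : ∀ z : ℝ, HasDerivAt (fun z : ℝ => l * z) l z := fun z => by
    simpa using (hasDerivAt_id z).const_mul l
  have hu : u = v * sin l / l := by field_simp; linarith
  have hy1 : cos l - h / l * sin l = 1 / v := by
    have : h * (v * sin l / l) = v * cos l - 1 := by rw [← hu]; linarith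
    field_simp at this ⊢
    linarith
  convert! exists_admissible (y := fun z => cos (l * z) - h / l * sin (l * z))
    (y' := fun z => -l * sin (l * z) - h * cos (l * z)) (S := fun z => sin (l * z) / l)
    (S' := fun z => cos (l * z)) (E := -l ^ 2) (κ := -l ^ 2 - h ^ 2) (u := u) hv ?_
    (by fun_prop) ?_ (by simp) (by simpa using hy1) ?_ ?_ (by simp)
    (by simp only [mul_one, hu]; ring) ?_ using 7
  · ring
  · intro z
    convert! (hd z).cos.sub ((hd z).sin.const_mul (h / l)) using 1
    field_simp
  · intro z hz
    have e : sin l * (cos (l * z) - h / l * sin (l * z)) = sin (l - l * z) + sin (l * z) / v := by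
      rw [sin_sub, div_eq_mul_one_div _ v, ← hy1]; ring
    have h1 : 0 ≤ sin (l - l * z) :=
      sin_nonneg_of_nonneg_of_le_pi (by nlinarith [hz.2]) (by nlinarith [hz.1, hl.2])
    have h2 : 0 < sin (l - l * z) + sin (l * z) / v := by
      rcases eq_or_lt_of_le hz.1 with h0 | h0
      · simp [← h0, hs]
      · have := sin_pos_of_pos_of_lt_pi (x := l * z) (by positivity) (by nlinarith [hz.2, hl.2])
        positivity
    rw [← e] at h2
    exact pos_of_mul_pos_right h2 hs.le
  · intro z
    have := sin_sq_add_cos_sq (l * z)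
    field_simp
    linear_combination (l ^ 2 + h ^ 2) * this
  · intro z
    convert! (hd z).sin.div_const l using 1
    field_simp
  · intro z
    have := sin_sq_add_cos_sq (l * z)
    field_simp
    linear_combination l * this

theorem ratefun_hyperbolic {u v β h : ℝ} (hv : 0 < v) (hβ : 0 < β)
    (hcosh : v * cosh β = 1 + h * u) (hsinh : v * sinh β = β * u) :
    ratefun u v = 4 * (β ^ 2 - (β ^ 2 - h ^ 2) * u) := by
  have hs : 0 < sinh β := sinh_pos_iff.2 hβ
  refine ratefun_eq_of_isLeast ?_ fun g h1 h2 h3 h4 =>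
    hyperbolic_lower_bound h1 h2 h3 h4
      (by rw [← cosh_add_sinh]; linarith) (by rw [← cosh_sub_sinh]; linarith)
  have hd : ∀ z : ℝ, HasDerivAt (fun z : ℝ => β * z) β z := fun z => by
    simpa using (hasDerivAt_id z).const_mul β
  have hu : u = v * sinh β / β := by field_simp; linarith
  have hy1 : cosh β - h / β * sinh β = 1 / v := by
    have : h * (v * sinh β / β) = v * cosh β - 1 := by rw [← hu]; linarith
    field_simp at this ⊢
    linarith
  refine exists_admissible (y := fun z => cosh (β * z) - h / β * sinh (β * z))
    (y' := fun z => β * sinh (β * z) - h * cosh (β * z)) (S := fun z => sinh (β * z) / β)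
    (S' := fun z => cosh (β * z)) hv ?_
    (by fun_prop) ?_ (by simp) (by simpa using hy1) ?_ ?_ (by simp)
    (by simp only [mul_one, hu]; ring) ?_
  · intro z
    convert! (hd z).cosh.sub ((hd z).sinh.const_mul (h / β)) using 1
    field_simp
  · intro z hz
    have e : sinh β * (cosh (β * z) - h / β * sinh (β * z)) =
        sinh (β - β * z) + sinh (β * z) / v := by
      rw [sinh_sub, div_eq_mul_one_div _ v, ← hy1]; ring
    have h1 : 0 ≤ sinh (β - β * z) := sinh_nonneg_iff.2 (by nlinarith [hz.2])
    have h2 : 0 < sinh (β - β * z) + sinh (β * z) / v := by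
      rcases eq_or_lt_of_le hz.1 with h0 | h0
      · simp [← h0, hβ]
      · have : 0 < sinh (β * z) := sinh_pos_iff.2 (by positivity)
        positivity
    rw [← e] at h2
    exact pos_of_mul_pos_right h2 hs.le
  · intro z
    have := cosh_sq_sub_sinh_sq (β * z)
    field_simp
    linear_combination (h ^ 2 - β ^ 2) * this
  · intro z
    convert! (hd z).sinh.div_const β using 1
    field_simp
  · intro z
    have := cosh_sq_sub_sinh_sq (β * z)
    field_simp
    linear_combination β * this

theorem ratefun_self {u : ℝ} (hu : 0 < u) : ratefun u u = 4 * (u - 1) ^ 2 / u := by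
  have hh : (u - 1) / u * u = u - 1 := by field_simp
  have key : ratefun u u = 4 * (0 ^ 2 - (0 ^ 2 - ((u - 1) / u) ^ 2) * u) := by
    refine ratefun_eq_of_isLeast ?_ fun g h1 h2 h3 h4 =>
      hyperbolic_lower_bound h1 h2 h3 h4 (by simp [hh]) (by simp [hh])
    refine exists_admissible (y := fun z => 1 - (u - 1) / u * z) (y' := fun _ => -((u - 1) / u))
      (S := fun z => z) (S' := fun _ => 1) hu ?_ (by fun_prop) ?_ (by simp) ?_ ?_
      (fun z => hasDerivAt_id z) rfl (one_mul u) ?_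
    · intro z
      simpa using ((hasDerivAt_id z).const_mul ((u - 1) / u)).const_sub 1
    · intro z hz
      have e : 1 - (u - 1) / u * z = (1 - z) + z / u := by field_simp; ring
      rw [e]
      rcases eq_or_lt_of_le hz.1 with h0 | h0
      · simp [← h0]
      · have : 0 < z / u := by positivity
        linarith [hz.2]
    · field_simp; ring
    · intro z; ring
    · intro z; ring
  rw [key]
  field_simp
  ring

theorem strictConvexOn_sinh : StrictConvexOn ℝ (Set.Ici 0) sinh := by
  refine strictConvexOn_of_deriv2_pos (convex_Ici 0) continuous_sinh.continuousOn fun x hx => ?_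
  rw [interior_Ici] at hx
  simpa using hx

theorem existsUnique_sinh_div {r : ℝ} (hr : 1 < r) :
    ∃! b : ℝ, 0 < b ∧ sinh (b / 2) / (b / 2) = r := by
  have hlt : ∀ a b : ℝ, 0 < a → a < b → sinh a / a < sinh b / b := fun a b ha hab => by
    simpa using strictConvexOn_sinh.secant_strict_mono (a := 0) (x := a) (y := b) (by simp)
      ha.le (ha.trans hab).le ha.ne' (ha.trans hab).ne' hab
  have hcont : Continuous (dslope sinh 0) := by
    rw [← continuousOn_univ, continuousOn_dslope Filter.univ_mem]
    exact ⟨continuous_sinh.continuousOn, differentiableAt_sinh⟩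
  have h0 : dslope sinh 0 0 = 1 := by simp
  have hval : ∀ x : ℝ, x ≠ 0 → dslope sinh 0 x = sinh x / x := fun x hx => by
    rw [dslope_of_ne _ hx, slope_def_field]; simp
  have hbig : r ≤ dslope sinh 0 (4 * r) := by
    rw [hval _ (by positivity), le_div_iff₀ (by positivity), sinh_eq]
    have h1 := quadratic_le_exp_of_nonneg (x := 4 * r) (by positivity)
    have h2 : exp (-(4 * r)) ≤ 1 := exp_le_one_iff.2 (by linarith)
    nlinarith
  obtain ⟨x, hx, hxr⟩ := intermediate_value_Icc (by positivity : 0 ≤ 4 * r) hcont.continuousOn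
    (show r ∈ Set.Icc (dslope sinh 0 0) (dslope sinh 0 (4 * r)) from ⟨by rw [h0]; exact hr.le, hbig⟩)
  have hx0 : 0 < x := by
    refine lt_of_le_of_ne hx.1 fun h => ?_
    rw [← h, h0] at hxr
    exact hr.ne hxr
  refine ⟨2 * x, ⟨by positivity, ?_⟩, ?_⟩
  · rw [mul_div_cancel_left₀ _ two_ne_zero, ← hval x hx0.ne', hxr]
  · rintro b ⟨hb, hbr⟩
    rw [hval x hx0.ne'] at hxr
    rcases lt_trichotomy (b / 2) x with h | h | h
    · linarith [hlt _ _ (half_pos hb) h]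
    · linarith
    · linarith [hlt _ _ hx0 h]

theorem existsUnique_sin_div {r : ℝ} (hr0 : 0 < r) (hr : r < 1) :
    ∃! l : ℝ, l ∈ Set.Ioo 0 π ∧ sin l / l = r := by
  have hlt : ∀ a b : ℝ, 0 < a → a < b → b < π → sin b / b < sin a / a := fun a b ha hab hb => by
    simpa using strictConcaveOn_sin_Icc.secant_strict_mono (a := 0) (x := a) (y := b)
      ⟨le_rfl, pi_pos.le⟩ ⟨ha.le, (hab.trans hb).le⟩ ⟨(ha.trans hab).le, hb.le⟩
      ha.ne' (ha.trans hab).ne' hab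
  obtain ⟨x, hx, hxr⟩ := intermediate_value_Icc' pi_pos.le continuous_sinc.continuousOn
    (show r ∈ Set.Icc (sinc π) (sinc 0) by
      rw [sinc_zero, sinc_of_ne_zero pi_ne_zero]; simp [hr0.le, hr.le])
  have hx0 : x ≠ 0 := by
    rintro rfl
    rw [sinc_zero] at hxr
    exact hr.ne' hxr
  have hxπ : x ≠ π := by
    rintro rfl
    rw [sinc_of_ne_zero pi_ne_zero, sin_pi, zero_div] at hxr
    exact hr0.ne hxr
  have hxI : x ∈ Set.Ioo 0 π := ⟨lt_of_le_of_ne hx.1 hx0.symm, lt_of_le_of_ne hx.2 hxπ⟩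
  rw [sinc_of_ne_zero hx0] at hxr
  refine ⟨x, ⟨hxI, hxr⟩, ?_⟩
  rintro l ⟨hl, hlr⟩
  rcases lt_trichotomy l x with h | h | h
  · linarith [hlt _ _ hl.1 h hxI.2]
  · exact h
  · linarith [hlt _ _ hxI.1 h hl.2]

theorem ratefun_of_sinh_div {u v b γ : ℝ} (hu : 0 < u) (hv : 0 < v) (hb : 0 < b)
    (hbr : sinh (b / 2) / (b / 2) = u / v)
    (hγ : γ = exp (b / 2) * (v * exp (b / 2) - 1) / (exp (b / 2) - v))
    (hvb : v ≠ exp (b / 2)) :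
    ratefun u v = b * (b - 4 * γ / (γ + 1) + 4 * γ / (exp b + γ)) := by
  have hsinh : v * sinh (b / 2) = b / 2 * u := by
    field_simp at hbr
    linarith
  have hcosh : v * cosh (b / 2) = 1 + (v * cosh (b / 2) - 1) / u * u := by field_simp; ring
  rw [ratefun_hyperbolic hv (half_pos hb) hcosh hsinh]
  have hu' : u = v * sinh (b / 2) / (b / 2) := by field_simp; linarith
  have hs1 : 1 < exp (b / 2) := one_lt_exp_iff.2 (half_pos hb)
  have he : exp b = exp (b / 2) ^ 2 := by rw [← exp_nat_mul]; congr 1; push_cast; ring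
  rw [sinh_eq, exp_neg] at hu'
  rw [cosh_eq, exp_neg, he, hγ]
  generalize exp (b / 2) = s at *
  have hs0 : 0 < s := by linarith
  have hsv : s - v ≠ 0 := sub_ne_zero.2 hvb.symm
  have hs2 : 0 < s ^ 2 - 1 := by nlinarith
  have e1 : s * (v * s - 1) / (s - v) + 1 = v * (s ^ 2 - 1) / (s - v) := by field_simp; ring
  have e2 : s ^ 2 + s * (v * s - 1) / (s - v) = s * (s ^ 2 - 1) / (s - v) := by field_simp; ring
  have e3 : u = v * (s ^ 2 - 1) / (s * b) := by rw [hu']; field_simp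
  rw [e1, e2, e3]
  field_simp
  ring

theorem ratefun_of_sin_div {u v l η : ℝ} (hu : 0 < u) (hv : 0 < v) (hl : l ∈ Set.Ioo 0 π)
    (hlr : sin l / l = u / v) (hη : η ∈ Set.Ioo (-(π / 2)) (π / 2))
    (htan : tan η = (v * cos l - 1) / (v * sin l)) :
    ratefun u v = 4 * l ^ 2 * (u / cos η ^ 2 - 1) := by
  have hl0 := hl.1
  have hsin : v * sin l = l * u := by
    field_simp at hlr
    linarith
  have hcos : v * cos l = 1 + (v * cos l - 1) / u * u := by field_simp; ring
  rw [ratefun_trig hv hl hcos hsin]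
  have hc : cos η ≠ 0 := (cos_pos_of_mem_Ioo hη).ne'
  rw [div_eq_mul_inv u, ← inv_one_add_tan_sq hc, inv_inv, htan, hsin]
  field_simp
  ring

/-- Explicit solution of the variational problem for the rate function `I(u,v)` in the three
cases `u/v > 1`, `u/v < 1` and `u = v`. -/
theorem ratefun_explicit (u v : ℝ) (hu : 0 < u) (hv : 0 < v) :
    -- (i) the case `u/v > 1`
    (1 < u / v →
      (∃! b : ℝ, 0 < b ∧ Real.sinh (b / 2) / (b / 2) = u / v) ∧
      (∀ b : ℝ, 0 < b → Real.sinh (b / 2) / (b / 2) = u / v →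
        ∀ γ : ℝ, γ = Real.exp (b / 2) * (v * Real.exp (b / 2) - 1) / (Real.exp (b / 2) - v) →
          v ≠ Real.exp (b / 2) → γ ≠ -1 → Real.exp b + γ ≠ 0 →
          ratefun u v = b * (b - 4 * γ / (γ + 1) + 4 * γ / (Real.exp b + γ)))) ∧
    -- (ii) the case `u/v < 1`
    (u / v < 1 →
      (∃! lam : ℝ, lam ∈ Set.Ioo 0 Real.pi ∧ Real.sin lam / lam = u / v) ∧
      (∀ lam : ℝ, lam ∈ Set.Ioo 0 Real.pi → Real.sin lam / lam = u / v →
        ∀ η : ℝ, η ∈ Set.Ioo (-(Real.pi / 2)) (Real.pi / 2) →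
          Real.tan η = (v * Real.cos lam - 1) / (v * Real.sin lam) →
          ratefun u v = 4 * lam ^ 2 * (u / Real.cos η ^ 2 - 1))) ∧
    -- (iii) the case `u = v`
    (u = v → ratefun u u = 4 * (u - 1) ^ 2 / u) := by
  refine ⟨fun h => ⟨existsUnique_sinh_div h, fun b hb hbr γ hγ hvb _ _ =>
    ratefun_of_sinh_div hu hv hb hbr hγ hvb⟩, fun h => ⟨existsUnique_sin_div (div_pos hu hv) h,
    fun l hl hlr η hη htan => ratefun_of_sin_div hu hv hl hlr hη htan⟩, fun _ => ratefun_self hu⟩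
end

section
/- Define the polynomial P(ε,η) := 12ε² − 24εη + 16η² − (12/5)ε³ + (36/5)ε²η − (56/5)εη² + (32/5)η³ + (109/175)ε⁴ − (436/175)ε³η + (1004/175)ε²η² − (1136/175)εη³ + (1552/525)η⁴. Then I(e^ε, e^η) = P(ε,η) + o((ε² + η²)²) as (ε,η) → (0,0); that is, lim_{(ε,η)→(0,0)} (I(e^ε,e^η) − P(ε,η))/(ε²+η²)² = 0. -/
open MeasureTheory ProbabilityTheory Filter Real

open Asymptotics Topology

lemma sq_integral_le_integral_sq {k : ℝ → ℝ} (hk : IntervalIntegrable k volume 0 1)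
    (hk2 : IntervalIntegrable (fun z => k z ^ 2) volume 0 1) {z : ℝ} (hz : z ∈ Set.Icc (0 : ℝ) 1) :
    (∫ t in (0 : ℝ)..z, k t) ^ 2 ≤ ∫ t in (0 : ℝ)..1, k t ^ 2 := by
  have hsub : Set.uIcc 0 z ⊆ Set.uIcc (0 : ℝ) 1 := by
    rw [Set.uIcc_of_le hz.1, Set.uIcc_of_le zero_le_one]
    exact Set.Icc_subset_Icc_right hz.2
  have h1 := hk.mono_set hsub
  have h2 := hk2.mono_set hsub
  set m := ∫ t in (0 : ℝ)..z, k t with hm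
  have hpos : 0 ≤ ∫ t in (0 : ℝ)..z, (k t - m) ^ 2 :=
    intervalIntegral.integral_nonneg hz.1 fun t _ => sq_nonneg _
  have hexp : ∫ t in (0 : ℝ)..z, (k t - m) ^ 2
      = (∫ t in (0 : ℝ)..z, k t ^ 2) - 2 * m * m + z * m ^ 2 := by
    have : ∀ t, (k t - m) ^ 2 = k t ^ 2 - 2 * m * k t + m ^ 2 := fun t => by ring
    simp only [this]
    rw [intervalIntegral.integral_add (h2.sub (h1.const_mul _)) intervalIntegrable_const,
      intervalIntegral.integral_sub h2 (h1.const_mul _), intervalIntegral.integral_const_mul,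
      intervalIntegral.integral_const, ← hm]
    simp
  have hmono : ∫ t in (0 : ℝ)..z, k t ^ 2 ≤ ∫ t in (0 : ℝ)..1, k t ^ 2 := by
    refine intervalIntegral.integral_mono_interval le_rfl hz.1 hz.2 ?_ hk2
    exact Eventually.of_forall fun t => sq_nonneg _
  nlinarith [sq_nonneg m, hz.2, mul_nonneg (sub_nonneg.2 hz.2) (sq_nonneg m)]

lemma integral_primitive_mul {q k : ℝ → ℝ} {a b : ℝ} (hq : IntervalIntegrable q volume a b)
    (hk : IntervalIntegrable k volume a b) (h0 : ∫ t in a..b, k t = 0) :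
    ∫ z in a..b, (∫ t in a..z, q t) * k z = -∫ z in a..b, q z * ∫ t in a..z, k t := by
  have hQ := hq.absolutelyContinuousOnInterval_intervalIntegral (c := a) (by simp)
  have hK := hk.absolutelyContinuousOnInterval_intervalIntegral (c := a) (by simp)
  have h := hQ.integral_mul_deriv_eq_deriv_mul hK
  have e1 : ∫ z in a..b, (∫ t in a..z, q t) * deriv (fun z => ∫ t in a..z, k t) z
      = ∫ z in a..b, (∫ t in a..z, q t) * k z := by
    refine intervalIntegral.integral_congr_ae ?_
    filter_upwards [hk.ae_hasDerivAt_integral] with x hx hx'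
    rw [(hx (Set.uIoc_subset_uIcc hx') a (by simp)).deriv]
  have e2 : ∫ z in a..b, deriv (fun z => ∫ t in a..z, q t) z * (∫ t in a..z, k t)
      = ∫ z in a..b, q z * ∫ t in a..z, k t := by
    refine intervalIntegral.integral_congr_ae ?_
    filter_upwards [hq.ae_hasDerivAt_integral] with x hx hx'
    rw [(hx (Set.uIoc_subset_uIcc hx') a (by simp)).deriv]
  rw [e1, e2, h0] at h
  simpa using h

lemma integral_sq_le_of_extremal {g g₀ : ℝ → ℝ} {l : ℝ}
    (hg : IntervalIntegrable g volume 0 1) (hg2 : IntervalIntegrable (fun z => g z ^ 2) volume 0 1)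
    (hg₀ : ContinuousOn g₀ (Set.uIcc 0 1))
    (hode : ∀ z ∈ Set.Icc (0 : ℝ) 1,
      g₀ z = g₀ 0 + ∫ t in (0 : ℝ)..z, l * exp (2 * ∫ s in (0 : ℝ)..t, g₀ s))
    (hl : |l| ≤ 1 / 16) (hE : ∫ z in (0 : ℝ)..1, g₀ z ^ 2 ≤ 1 / 16)
    (hend : ∫ z in (0 : ℝ)..1, g z = ∫ z in (0 : ℝ)..1, g₀ z)
    (hexp : ∫ z in (0 : ℝ)..1, exp (2 * ∫ t in (0 : ℝ)..z, g t)
      = ∫ z in (0 : ℝ)..1, exp (2 * ∫ t in (0 : ℝ)..z, g₀ t)) :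
    ∫ z in (0 : ℝ)..1, g₀ z ^ 2 ≤ ∫ z in (0 : ℝ)..1, g z ^ 2 := by
  by_contra! hlt
  have hi₀ : IntervalIntegrable g₀ volume 0 1 := hg₀.intervalIntegrable
  have hi₀2 : IntervalIntegrable (fun z => g₀ z ^ 2) volume 0 1 := (hg₀.pow 2).intervalIntegrable
  set k : ℝ → ℝ := fun z => g z - g₀ z with hk
  have hki : IntervalIntegrable k volume 0 1 := hg.sub hi₀
  have hgk : IntervalIntegrable (fun z => g₀ z * k z) volume 0 1 := hki.continuousOn_mul hg₀
  have hk2 : IntervalIntegrable (fun z => k z ^ 2) volume 0 1 := by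
    have := (hg2.sub hi₀2).sub (hgk.const_mul 2)
    refine this.congr fun z _ => ?_
    simp only [hk]; ring
  set F : ℝ → ℝ := fun z => ∫ t in (0 : ℝ)..z, g t with hF
  set F₀ : ℝ → ℝ := fun z => ∫ t in (0 : ℝ)..z, g₀ t with hF₀
  set K : ℝ → ℝ := fun z => ∫ t in (0 : ℝ)..z, k t with hKdef
  have hFc : ContinuousOn F (Set.uIcc 0 1) :=
    intervalIntegral.continuousOn_primitive_interval' hg (by simp)
  have hF₀c : ContinuousOn F₀ (Set.uIcc 0 1) :=
    intervalIntegral.continuousOn_primitive_interval' hi₀ (by simp)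
  have hKc : ContinuousOn K (Set.uIcc 0 1) :=
    intervalIntegral.continuousOn_primitive_interval' hki (by simp)
  have hKF : ∀ z ∈ Set.Icc (0 : ℝ) 1, F z = F₀ z + K z := by
    intro z hz
    have hsub : Set.uIcc 0 z ⊆ Set.uIcc (0 : ℝ) 1 := by
      rw [Set.uIcc_of_le hz.1, Set.uIcc_of_le zero_le_one]
      exact Set.Icc_subset_Icc_right hz.2
    simp only [hF, hF₀, hKdef, hk]
    rw [intervalIntegral.integral_sub (hg.mono_set hsub) (hi₀.mono_set hsub)]
    ring
  have hFb : ∀ z ∈ Set.Icc (0 : ℝ) 1, |F z| ≤ 1 / 4 := fun z hz =>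
    abs_le_of_sq_le_sq (by linarith [sq_integral_le_integral_sq hg hg2 hz]) (by norm_num)
  have hF₀b : ∀ z ∈ Set.Icc (0 : ℝ) 1, |F₀ z| ≤ 1 / 4 := fun z hz =>
    abs_le_of_sq_le_sq (by linarith [sq_integral_le_integral_sq hi₀ hi₀2 hz]) (by norm_num)
  set w : ℝ → ℝ := fun z => exp (2 * F₀ z) with hw
  have hwc : ContinuousOn w (Set.uIcc 0 1) := by fun_prop
  have hwb : ∀ z ∈ Set.Icc (0 : ℝ) 1, w z ≤ 2 := by
    intro z hz
    have h1 : |2 * F₀ z| ≤ 1 / 2 := by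
      rw [abs_mul, abs_two]; linarith [hF₀b z hz]
    have h2 := abs_exp_sub_one_sub_id_le (h1.trans (by norm_num))
    have h3 := abs_le.1 h1
    have h4 := (abs_le.1 h2).2
    simp only [hw]
    nlinarith
  have hcross : ∫ z in (0 : ℝ)..1, g₀ z * k z = -(l * ∫ z in (0 : ℝ)..1, w z * K z) := by
    have hk0 : ∫ z in (0 : ℝ)..1, k z = 0 := by
      simp only [hk]
      rw [intervalIntegral.integral_sub hg hi₀, hend, sub_self]
    have hlw : IntervalIntegrable (fun z => l * w z) volume 0 1 :=
      (hwc.const_smul l).intervalIntegrable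
    have h := integral_primitive_mul hlw hki hk0
    have h2 : ∫ z in (0 : ℝ)..1, g₀ z * k z
        = ∫ z in (0 : ℝ)..1, (g₀ 0 * k z + (∫ t in (0 : ℝ)..z, l * w t) * k z) := by
      refine intervalIntegral.integral_congr fun z hz => ?_
      rw [Set.uIcc_of_le zero_le_one] at hz
      rw [hode z hz]
      ring
    rw [h2, intervalIntegral.integral_add (hki.const_mul _)
      (hki.continuousOn_mul (intervalIntegral.continuousOn_primitive_interval' hlw (by simp))), h,
      intervalIntegral.integral_const_mul, hk0, ← intervalIntegral.integral_const_mul]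
    simp only [mul_zero, zero_add, mul_assoc, hKdef]
  have hsplit : ∫ z in (0 : ℝ)..1, g z ^ 2 = (∫ z in (0 : ℝ)..1, g₀ z ^ 2)
      + 2 * (∫ z in (0 : ℝ)..1, g₀ z * k z) + ∫ z in (0 : ℝ)..1, k z ^ 2 := by
    rw [← intervalIntegral.integral_const_mul, ← intervalIntegral.integral_add hi₀2
      (hgk.const_mul 2), ← intervalIntegral.integral_add (hi₀2.add (hgk.const_mul 2)) hk2]
    refine intervalIntegral.integral_congr fun z _ => ?_
    simp only [hk]; ring
  set N := ∫ z in (0 : ℝ)..1, k z ^ 2 with hN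
  have hKb : ∀ z ∈ Set.Icc (0 : ℝ) 1, K z ^ 2 ≤ N := fun z hz =>
    sq_integral_le_integral_sq hki hk2 hz
  have hzero : ∫ z in (0 : ℝ)..1, w z * (exp (2 * K z) - 1) = 0 := by
    have : ∫ z in (0 : ℝ)..1, w z * (exp (2 * K z) - 1)
        = ∫ z in (0 : ℝ)..1, (exp (2 * F z) - w z) := by
      refine intervalIntegral.integral_congr fun z hz => ?_
      rw [Set.uIcc_of_le zero_le_one] at hz
      simp only [hw]
      rw [hKF z hz, mul_add, exp_add]; ring
    rw [this, intervalIntegral.integral_sub _ hwc.intervalIntegrable, hexp, sub_self]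
    exact ContinuousOn.intervalIntegrable (by fun_prop)
  have hquad : |∫ z in (0 : ℝ)..1, w z * K z| ≤ 4 * N := by
    have h1 : 2 * ∫ z in (0 : ℝ)..1, w z * K z
        = -∫ z in (0 : ℝ)..1, w z * (exp (2 * K z) - 1 - 2 * K z) := by
      have : ∀ z, w z * (exp (2 * K z) - 1 - 2 * K z)
          = w z * (exp (2 * K z) - 1) - 2 * (w z * K z) := fun z => by ring
      simp only [this]
      rw [intervalIntegral.integral_sub (ContinuousOn.intervalIntegrable (by fun_prop))
        (ContinuousOn.intervalIntegrable (by fun_prop)), hzero,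
        intervalIntegral.integral_const_mul]
      ring
    have h2 : ‖∫ z in (0 : ℝ)..1, w z * (exp (2 * K z) - 1 - 2 * K z)‖ ≤ 8 * N * |(1 : ℝ) - 0| := by
      refine intervalIntegral.norm_integral_le_of_norm_le_const fun z hz => ?_
      rw [Set.uIoc_of_le zero_le_one] at hz
      have hz' : z ∈ Set.Icc (0 : ℝ) 1 := Set.Ioc_subset_Icc_self hz
      have hK : |2 * K z| ≤ 1 := by
        have e : 2 * K z = 2 * F z - 2 * F₀ z := by rw [hKF z hz']; ring
        have a := abs_le.1 (hFb z hz')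
        have b := abs_le.1 (hF₀b z hz')
        rw [e, abs_le]; constructor <;> linarith [a.1, a.2, b.1, b.2]
      have h3 := abs_exp_sub_one_sub_id_le hK
      have hw0 : 0 < w z := exp_pos _
      rw [norm_mul, Real.norm_eq_abs, Real.norm_eq_abs, abs_of_pos hw0]
      calc w z * |exp (2 * K z) - 1 - 2 * K z| ≤ 2 * (2 * K z) ^ 2 := by
            gcongr
            exact hwb z hz'
        _ ≤ 8 * N := by linarith [hKb z hz']
    rw [Real.norm_eq_abs, sub_zero, abs_one, mul_one] at h2
    have h4 : 2 * |∫ z in (0 : ℝ)..1, w z * K z| ≤ 8 * N := by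
      rw [← abs_two, ← abs_mul, h1, abs_neg]; exact h2
    linarith
  have hN0 : 0 ≤ N := (sq_nonneg _).trans (hKb 0 (by simp))
  have hprod : |l * ∫ z in (0 : ℝ)..1, w z * K z| ≤ 1 / 16 * (4 * N) := by
    rw [abs_mul]
    gcongr
  have := (abs_le.1 hprod).2
  rw [hsplit, hcross] at hlt
  linarith

/-- The entire function equal to `cosh √c` for `c ≥ 0` and to `cos √(-c)` for `c ≤ 0`. -/
noncomputable def coshSqrt (c : ℝ) : ℝ := ∑' n : ℕ, c ^ n * (1 / ((2 * n).factorial : ℝ))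

/-- The entire function equal to `sinh √c / √c` for `c > 0` and to `sin √(-c) / √(-c)` for
`c < 0`. -/
noncomputable def sinhcSqrt (c : ℝ) : ℝ := ∑' n : ℕ, c ^ n * (1 / ((2 * n + 1).factorial : ℝ))

lemma coshSqrt_sq (k : ℝ) : coshSqrt (k ^ 2) = cosh k := by
  rw [cosh_eq_tsum, coshSqrt]
  exact tsum_congr fun n => by rw [← pow_mul]; ring

lemma mul_sinhcSqrt_sq (k : ℝ) : k * sinhcSqrt (k ^ 2) = sinh k := by
  rw [sinh_eq_tsum, sinhcSqrt, ← tsum_mul_left]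
  exact tsum_congr fun n => by rw [← pow_mul]; ring

lemma coshSqrt_neg_sq (k : ℝ) : coshSqrt (-k ^ 2) = cos k := by
  rw [cos_eq_tsum, coshSqrt]
  exact tsum_congr fun n => by rw [neg_pow, ← pow_mul]; ring

lemma mul_sinhcSqrt_neg_sq (k : ℝ) : k * sinhcSqrt (-k ^ 2) = sin k := by
  rw [sin_eq_tsum, sinhcSqrt, ← tsum_mul_left]
  exact tsum_congr fun n => by rw [neg_pow, ← pow_mul]; ring

lemma coshSqrt_zero : coshSqrt 0 = 1 := by simpa using coshSqrt_sq 0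

lemma sinhcSqrt_zero : sinhcSqrt 0 = 1 := by
  rw [sinhcSqrt, tsum_eq_single 0 fun n hn => by simp [hn]]
  simp

lemma hasDerivAt_coshSqrt_and_sinhcSqrt (c z : ℝ) :
    HasDerivAt (fun z => coshSqrt (c * z ^ 2)) (c * (z * sinhcSqrt (c * z ^ 2))) z ∧
      HasDerivAt (fun z => z * sinhcSqrt (c * z ^ 2)) (coshSqrt (c * z ^ 2)) z := by
  rcases lt_trichotomy c 0 with hc | rfl | hc
  · obtain ⟨k, hk, rfl⟩ : ∃ k : ℝ, k ≠ 0 ∧ c = -k ^ 2 :=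
      ⟨√(-c), (sqrt_pos.2 (neg_pos.2 hc)).ne', by rw [sq_sqrt (neg_pos.2 hc).le, neg_neg]⟩
    have e1 : ∀ z, coshSqrt (-k ^ 2 * z ^ 2) = cos (k * z) := fun z => by
      rw [← coshSqrt_neg_sq]; congr 1; ring
    have e2 : ∀ z, z * sinhcSqrt (-k ^ 2 * z ^ 2) = sin (k * z) / k := fun z => by
      rw [← mul_sinhcSqrt_neg_sq, eq_div_iff hk]
      rw [show -(k * z) ^ 2 = -k ^ 2 * z ^ 2 by ring]; ring
    have hlin : HasDerivAt (fun z => k * z) k z := by simpa using (hasDerivAt_id z).const_mul k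
    simp only [e1, e2]
    refine ⟨hlin.cos.congr_deriv ?_, (hlin.sin.div_const k).congr_deriv ?_⟩ <;> field_simp
  · simp only [zero_mul, coshSqrt_zero, sinhcSqrt_zero, mul_one]
    exact ⟨hasDerivAt_const z 1, hasDerivAt_id z⟩
  · obtain ⟨k, hk, rfl⟩ : ∃ k : ℝ, k ≠ 0 ∧ c = k ^ 2 :=
      ⟨√c, (sqrt_pos.2 hc).ne', by rw [sq_sqrt hc.le]⟩
    have e1 : ∀ z, coshSqrt (k ^ 2 * z ^ 2) = cosh (k * z) := fun z => by
      rw [← coshSqrt_sq]; congr 1; ring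
    have e2 : ∀ z, z * sinhcSqrt (k ^ 2 * z ^ 2) = sinh (k * z) / k := fun z => by
      rw [← mul_sinhcSqrt_sq, eq_div_iff hk]
      rw [show (k * z) ^ 2 = k ^ 2 * z ^ 2 by ring]; ring
    have hlin : HasDerivAt (fun z => k * z) k z := by simpa using (hasDerivAt_id z).const_mul k
    simp only [e1, e2]
    refine ⟨hlin.cosh.congr_deriv ?_, (hlin.sinh.div_const k).congr_deriv ?_⟩ <;> field_simp

lemma coshSqrt_sq_sub_mul_sinhcSqrt_sq (c z : ℝ) :
    coshSqrt (c * z ^ 2) ^ 2 - c * (z * sinhcSqrt (c * z ^ 2)) ^ 2 = 1 := by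
  have hd : ∀ z : ℝ, HasDerivAt
      (fun z => coshSqrt (c * z ^ 2) ^ 2 - c * (z * sinhcSqrt (c * z ^ 2)) ^ 2) 0 z := fun z =>
    have ⟨h1, h2⟩ := hasDerivAt_coshSqrt_and_sinhcSqrt c z
    ((h1.fun_pow 2).fun_sub ((h2.fun_pow 2).const_mul c)).congr_deriv (by ring)
  have := is_const_of_deriv_eq_zero (fun z => (hd z).differentiableAt) (fun z => (hd z).deriv) z 0
  simpa [coshSqrt_zero] using this

lemma abs_tsum_sub_sum_le {a : ℕ → ℝ} (ha : ∀ n, |a n| ≤ 1 / (n.factorial : ℝ)) {c : ℝ}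
    (hc : |c| ≤ 1) (N : ℕ) :
    |(∑' n, c ^ n * a n) - ∑ n ∈ Finset.range N, c ^ n * a n| ≤ 3 * |c| ^ N := by
  have hfac : Summable fun n : ℕ => 1 / (n.factorial : ℝ) := by
    simpa using summable_pow_div_factorial 1
  have hs : Summable fun n => c ^ n * a n := by
    refine Summable.of_norm_bounded hfac fun n => ?_
    rw [norm_mul, norm_pow, Real.norm_eq_abs, Real.norm_eq_abs]
    exact (mul_le_of_le_one_left (abs_nonneg _) (pow_le_one₀ (abs_nonneg _) hc)).trans (ha n)
  rw [← hs.sum_add_tsum_nat_add N, add_sub_cancel_left]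
  have hexp : HasSum (fun n : ℕ => |c| ^ N * (1 / (n.factorial : ℝ))) (|c| ^ N * exp 1) := by
    refine HasSum.mul_left _ ?_
    have := NormedSpace.expSeries_div_hasSum_exp (𝔸 := ℝ) 1
    rw [← Real.exp_eq_exp_ℝ] at this
    simpa using this
  have hb := tsum_of_norm_bounded hexp (f := fun n => c ^ (n + N) * a (n + N)) fun n => ?_
  · rw [Real.norm_eq_abs] at hb
    refine hb.trans ?_
    rw [mul_comm]
    gcongr
    exact exp_one_lt_three.le
  · rw [norm_mul, norm_pow, Real.norm_eq_abs, Real.norm_eq_abs, pow_add, mul_comm (|c| ^ n),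
      mul_assoc]
    gcongr
    refine (mul_le_of_le_one_left (abs_nonneg _) (pow_le_one₀ (abs_nonneg _) hc)).trans
      ((ha _).trans ?_)
    gcongr
    exact Nat.le_add_right n N

lemma abs_coshSqrt_sub_sum_le {c : ℝ} (hc : |c| ≤ 1) (N : ℕ) :
    |coshSqrt c - ∑ n ∈ Finset.range N, c ^ n * (1 / ((2 * n).factorial : ℝ))|
      ≤ 3 * |c| ^ N := by
  refine abs_tsum_sub_sum_le (fun n => ?_) hc N
  rw [abs_of_nonneg (by positivity)]
  gcongr
  omega

lemma abs_sinhcSqrt_sub_sum_le {c : ℝ} (hc : |c| ≤ 1) (N : ℕ) :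
    |sinhcSqrt c - ∑ n ∈ Finset.range N, c ^ n * (1 / ((2 * n + 1).factorial : ℝ))|
      ≤ 3 * |c| ^ N := by
  refine abs_tsum_sub_sum_le (fun n => ?_) hc N
  rw [abs_of_nonneg (by positivity)]
  gcongr
  omega

lemma continuousOn_sinhcSqrt : ContinuousOn sinhcSqrt (Set.Icc (-1) 1) := by
  refine continuousOn_tsum (u := fun n : ℕ => 1 / (n.factorial : ℝ)) (fun n => by fun_prop)
    (by simpa using summable_pow_div_factorial 1) fun n c hc => ?_
  rw [norm_mul, norm_pow, Real.norm_eq_abs, Real.norm_eq_abs,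
    abs_of_nonneg (by positivity : (0 : ℝ) ≤ 1 / ((2 * n + 1).factorial : ℝ))]
  refine (mul_le_of_le_one_left (by positivity)
    (pow_le_one₀ (abs_nonneg _) (abs_le.2 hc))).trans ?_
  gcongr
  omega

lemma ratefun_eq_of_extremal {h h' : ℝ → ℝ} {c l : ℝ} (hh : ∀ z, HasDerivAt h (h' z) z)
    (hh' : ∀ z, HasDerivAt h' (c * h z) z) (h0 : h 0 = 1)
    (hcons : ∀ z, h' z ^ 2 = l + c * h z ^ 2) (hl : |l| ≤ 1 / 16)
    (hlow : ∀ z ∈ Set.Icc (0 : ℝ) 1, 1 / 2 ≤ h z)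
    (hsmall : ∀ z ∈ Set.Icc (0 : ℝ) 1, |h' z| ≤ 1 / 8) :
    ratefun (∫ z in (0 : ℝ)..1, (h z ^ 2)⁻¹) (h 1)⁻¹
      = 4 * (l * (∫ z in (0 : ℝ)..1, (h z ^ 2)⁻¹) + c) := by
  have hpos : ∀ z ∈ Set.Icc (0 : ℝ) 1, 0 < h z := fun z hz => by linarith [hlow z hz]
  have hI : Set.uIcc (0 : ℝ) 1 = Set.Icc 0 1 := Set.uIcc_of_le zero_le_one
  have hne : ∀ z ∈ Set.uIcc (0 : ℝ) 1, h z ≠ 0 := fun z hz => (hpos z (hI ▸ hz)).ne'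
  have hhc : Continuous h := continuous_iff_continuousAt.2 fun z => (hh z).continuousAt
  have hhc' : Continuous h' := continuous_iff_continuousAt.2 fun z => (hh' z).continuousAt
  set g₀ : ℝ → ℝ := fun z => -(h' z / h z) with hg₀
  have hg₀c : ContinuousOn g₀ (Set.uIcc 0 1) := (hhc'.continuousOn.div hhc.continuousOn hne).neg
  have hsub : ∀ {z : ℝ}, z ∈ Set.Icc (0 : ℝ) 1 → Set.uIcc 0 z ⊆ Set.uIcc (0 : ℝ) 1 := by
    intro z hz
    rw [Set.uIcc_of_le hz.1, hI]
    exact Set.Icc_subset_Icc_right hz.2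
  have hwc : ContinuousOn (fun z => (h z ^ 2)⁻¹) (Set.uIcc 0 1) :=
    (hhc.continuousOn.pow 2).inv₀ fun z hz => pow_ne_zero 2 (hne z hz)
  have hlwc : ContinuousOn (fun z => l * (h z ^ 2)⁻¹) (Set.uIcc 0 1) := hwc.const_smul l
  have hprim : ∀ z ∈ Set.Icc (0 : ℝ) 1, ∫ t in (0 : ℝ)..z, g₀ t = -log (h z) := by
    intro z hz
    rw [intervalIntegral.integral_eq_sub_of_hasDerivAt (f := fun t => -log (h t))
      (fun t ht => ((hh t).log (hne t (hsub hz ht))).neg)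
      (hg₀c.mono (hsub hz)).intervalIntegrable]
    simp [h0]
  have hexp₀ : ∀ z ∈ Set.Icc (0 : ℝ) 1, exp (2 * ∫ t in (0 : ℝ)..z, g₀ t) = (h z ^ 2)⁻¹ := by
    intro z hz
    rw [hprim z hz, mul_neg, exp_neg, mul_comm, exp_mul, exp_log (hpos z hz)]
    norm_cast
  have hint : ∫ z in (0 : ℝ)..1, exp (2 * ∫ t in (0 : ℝ)..z, g₀ t)
      = ∫ z in (0 : ℝ)..1, (h z ^ 2)⁻¹ :=
    intervalIntegral.integral_congr fun z hz => hexp₀ z (hI ▸ hz)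
  have hode : ∀ z ∈ Set.Icc (0 : ℝ) 1,
      g₀ z = g₀ 0 + ∫ t in (0 : ℝ)..z, l * exp (2 * ∫ s in (0 : ℝ)..t, g₀ s) := by
    intro z hz
    have hc : ∫ t in (0 : ℝ)..z, l * exp (2 * ∫ s in (0 : ℝ)..t, g₀ s)
        = ∫ t in (0 : ℝ)..z, l * (h t ^ 2)⁻¹ :=
      intervalIntegral.integral_congr fun t ht => by
        simp only [hexp₀ t (hI ▸ hsub hz ht)]
    rw [hc, intervalIntegral.integral_eq_sub_of_hasDerivAt (f := g₀) (fun t ht => ?_)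
      (hlwc.mono (hsub hz)).intervalIntegrable]
    · ring
    · have hn := hne t (hsub hz ht)
      refine ((hh' t).div (hh t) hn).neg.congr_deriv ?_
      have := hcons t
      field_simp
      linarith
  have hval : ∫ z in (0 : ℝ)..1, g₀ z ^ 2 = l * (∫ z in (0 : ℝ)..1, (h z ^ 2)⁻¹) + c := by
    have : ∫ z in (0 : ℝ)..1, g₀ z ^ 2 = ∫ z in (0 : ℝ)..1, (l * (h z ^ 2)⁻¹ + c) :=
      intervalIntegral.integral_congr fun z hz => by
        have hn := hne z hz
        simp only [hg₀, neg_sq, div_pow, hcons z]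
        field_simp
    rw [this, intervalIntegral.integral_add hlwc.intervalIntegrable
      intervalIntegrable_const, intervalIntegral.integral_const_mul]
    simp
  have hE : ∫ z in (0 : ℝ)..1, g₀ z ^ 2 ≤ 1 / 16 := by
    have hb : ∀ z ∈ Set.Icc (0 : ℝ) 1, g₀ z ^ 2 ≤ 1 / 16 := by
      intro z hz
      have : |g₀ z| ≤ 1 / 4 := by
        rw [hg₀, abs_neg, abs_div, abs_of_pos (hpos z hz), div_le_iff₀ (hpos z hz)]
        linarith [hsmall z hz, hlow z hz]
      calc g₀ z ^ 2 = |g₀ z| ^ 2 := (sq_abs _).symm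
        _ ≤ (1 / 4) ^ 2 := by gcongr
        _ = 1 / 16 := by norm_num
    have := intervalIntegral.integral_mono_on zero_le_one (hg₀c.pow 2).intervalIntegrable
      (intervalIntegrable_const (μ := volume) (c := (1 / 16 : ℝ))) hb
    simpa using this
  have hend : exp (∫ t in (0 : ℝ)..1, g₀ t) = (h 1)⁻¹ := by
    rw [hprim 1 (by simp), exp_neg, exp_log (hpos 1 (by simp))]
  refine IsLeast.csInf_eq ⟨⟨g₀, hg₀c.intervalIntegrable, (hg₀c.pow 2).intervalIntegrable,
    hint, hend, by rw [hval]⟩, ?_⟩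
  rintro r ⟨g, hg, hg2, hgu, hgv, rfl⟩
  rw [← hval]
  gcongr
  exact integral_sq_le_of_extremal hg hg2 hg₀c hode hl hE
    (exp_injective (hgv.trans hend.symm)) (hgu.trans hint.symm)

lemma ratefun_sinhcSqrt_mul_exp {c η : ℝ} (hc : |c| ≤ 1 / 1000) (hη : |η| ≤ 1 / 1000) :
    ratefun (sinhcSqrt c * exp η) (exp η)
      = 4 * c + 8 * (cosh η - coshSqrt c) / sinhcSqrt c := by
  have hcosh : ∀ z ∈ Set.Icc (0 : ℝ) 1, |coshSqrt (c * z ^ 2) - 1| ≤ 3 / 1000 ∧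
      |sinhcSqrt (c * z ^ 2) - 1| ≤ 3 / 1000 := by
    intro z hz
    have hz2 : |c * z ^ 2| ≤ 1 / 1000 := by
      rw [abs_mul, abs_of_nonneg (sq_nonneg z)]
      exact (mul_le_of_le_one_right (abs_nonneg c) (pow_le_one₀ hz.1 hz.2)).trans hc
    have h1 := abs_coshSqrt_sub_sum_le (hz2.trans (by norm_num)) 1
    have h2 := abs_sinhcSqrt_sub_sum_le (hz2.trans (by norm_num)) 1
    simp only [Finset.sum_range_one, pow_zero, mul_zero, zero_add, Nat.factorial_zero,
      Nat.factorial_one, Nat.cast_one, div_one, mul_one, pow_one] at h1 h2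
    constructor <;> linarith
  obtain ⟨hC, hS⟩ := hcosh 1 (by simp)
  simp only [one_pow, mul_one] at hC hS
  set C := coshSqrt c with hCdef
  set S := sinhcSqrt c with hSdef
  have hCS : C ^ 2 - c * S ^ 2 = 1 := by
    have := coshSqrt_sq_sub_mul_sinhcSqrt_sq c 1
    simpa using this
  have hS0 : 0 < S := by linarith [(abs_le.1 hS).1]
  have hexp : |exp (-η) - 1| ≤ 2 / 1000 := by
    have h1 := abs_exp_sub_one_le (x := -η) (by rw [abs_neg]; linarith)
    rw [abs_neg] at h1
    linarith
  set b := (exp (-η) - C) / S with hb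
  have hbS : C + b * S = exp (-η) := by rw [hb]; field_simp; ring
  have hbb : |b| ≤ 6 / 1000 := by
    rw [hb, abs_div, abs_of_pos hS0, div_le_iff₀ hS0, abs_le]
    have a1 := abs_le.1 hexp
    have a2 := abs_le.1 hC
    have a3 := abs_le.1 hS
    constructor <;> linarith [a1.1, a1.2, a2.1, a2.2, a3.1, a3.2]
  set si : ℝ → ℝ := fun z => z * sinhcSqrt (c * z ^ 2) with hsi
  set co : ℝ → ℝ := fun z => coshSqrt (c * z ^ 2) with hco
  have hdco : ∀ z, HasDerivAt co (c * si z) z := fun z =>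
    (hasDerivAt_coshSqrt_and_sinhcSqrt c z).1
  have hdsi : ∀ z, HasDerivAt si (co z) z := fun z => (hasDerivAt_coshSqrt_and_sinhcSqrt c z).2
  have hpyth : ∀ z, co z ^ 2 - c * si z ^ 2 = 1 := coshSqrt_sq_sub_mul_sinhcSqrt_sq c
  have hsib : ∀ z ∈ Set.Icc (0 : ℝ) 1, |si z| ≤ 2 := by
    intro z hz
    rw [hsi, abs_mul, abs_of_nonneg hz.1]
    have h2 : |sinhcSqrt (c * z ^ 2)| ≤ 2 := by
      have := abs_le.1 (hcosh z hz).2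
      rw [abs_le]; constructor <;> linarith [this.1, this.2]
    nlinarith [hz.1, hz.2, abs_nonneg (sinhcSqrt (c * z ^ 2))]
  have hbsi : ∀ z ∈ Set.Icc (0 : ℝ) 1, |b * si z| ≤ 6 / 1000 * 2 := fun z hz => by
    rw [abs_mul]; gcongr; exact hsib z hz
  have hlow : ∀ z ∈ Set.Icc (0 : ℝ) 1, 1 / 2 ≤ co z + b * si z := fun z hz => by
    linarith [(abs_le.1 (hbsi z hz)).1, (abs_le.1 (hcosh z hz).1).1]
  have hco1 : co 1 = C := by simp [hco, hCdef]
  have hsi1 : si 1 = S := by simp [hsi, hSdef]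
  have hu : ∫ z in (0 : ℝ)..1, ((co z + b * si z) ^ 2)⁻¹ = S * exp η := by
    have hne : ∀ z ∈ Set.uIcc (0 : ℝ) 1, co z + b * si z ≠ 0 := fun z hz => by
      rw [Set.uIcc_of_le zero_le_one] at hz
      linarith [hlow z hz]
    rw [intervalIntegral.integral_eq_sub_of_hasDerivAt (f := fun z => si z / (co z + b * si z))]
    · simp only [hco1, hsi1, hbS, exp_neg]
      simp [hsi]
    · intro z hz
      have hn := hne z hz
      refine ((hdsi z).div ((hdco z).add ((hdsi z).const_mul b)) hn).congr_deriv ?_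
      rw [inv_eq_one_div]
      simp only [Pi.add_apply]
      congr 1
      linear_combination hpyth z
    · refine ContinuousOn.intervalIntegrable (ContinuousOn.inv₀ ?_ fun z hz =>
        pow_ne_zero 2 (hne z hz))
      have h1 : Continuous co := continuous_iff_continuousAt.2 fun z => (hdco z).continuousAt
      have h2 : Continuous si := continuous_iff_continuousAt.2 fun z => (hdsi z).continuousAt
      fun_prop
  have key := ratefun_eq_of_extremal (h := fun z => co z + b * si z)
    (h' := fun z => c * si z + b * co z) (c := c) (l := b ^ 2 - c)
    (fun z => (hdco z).add ((hdsi z).const_mul b))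
    (fun z => (((hdsi z).const_mul c).add ((hdco z).const_mul b)).congr_deriv (by ring))
    (by simp [hco, hsi, coshSqrt_zero])
    (fun z => by linear_combination (b ^ 2 - c) * hpyth z) ?_ hlow fun z hz => ?_
  · rw [hu] at key
    simp only [hco1, hsi1, hbS, exp_neg, inv_inv] at key
    rw [key, cosh_eq]
    have hb' : b * S = exp (-η) - C := by linarith
    have hee : exp (-η) * exp η = 1 := by rw [← exp_add]; simp
    rw [eq_comm, ← sub_eq_zero]
    clear_value b
    have hfin : (4 * c + 8 * ((exp η + exp (-η)) / 2 - C) / S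
        - 4 * ((b ^ 2 - c) * (S * exp η) + c)) * S = 0 := by
      field_simp
      linear_combination (-8 * exp η * (b * S + exp (-η) - C)) * hb'
        + (16 * C - 8 * exp (-η)) * hee - 8 * exp η * hCS
    exact (mul_eq_zero.1 hfin).resolve_right hS0.ne'
  · have h1 : b ^ 2 ≤ (6 / 1000) ^ 2 := sq_le_sq' (by linarith [(abs_le.1 hbb).1])
      (abs_le.1 hbb).2
    have h2 := abs_le.1 hc
    rw [abs_le]
    constructor <;> nlinarith [sq_nonneg b, h2.1, h2.2]
  · have h1 : |c * si z| ≤ 1 / 1000 * 2 := by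
      rw [abs_mul]; gcongr; exact hsib z hz
    have h2 : |b * co z| ≤ 6 / 1000 * 2 := by
      rw [abs_mul]
      gcongr
      have := abs_le.1 (hcosh z hz).1
      rw [abs_le]; constructor <;> linarith [this.1, this.2]
    exact (abs_add_le _ _).trans (by linarith)

lemma coshSqrt_sub_taylor_isBigO :
    (fun c : ℝ => coshSqrt c - (1 + c / 2 + c ^ 2 / 24 + c ^ 3 / 720 + c ^ 4 / 40320))
      =O[𝓝 0] fun c => c ^ 5 := by
  refine IsBigO.of_bound 3 ?_
  filter_upwards [Metric.closedBall_mem_nhds (0 : ℝ) one_pos] with c hc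
  have h := abs_coshSqrt_sub_sum_le (by simpa using hc) 5
  rw [norm_pow, Real.norm_eq_abs, Real.norm_eq_abs]
  convert h using 3
  norm_num [Finset.sum_range_succ, Nat.factorial]
  ring

lemma sinhcSqrt_sub_taylor_isBigO :
    (fun c : ℝ => sinhcSqrt c - (1 + c / 6 + c ^ 2 / 120 + c ^ 3 / 5040 + c ^ 4 / 362880))
      =O[𝓝 0] fun c => c ^ 5 := by
  refine IsBigO.of_bound 3 ?_
  filter_upwards [Metric.closedBall_mem_nhds (0 : ℝ) one_pos] with c hc
  have h := abs_sinhcSqrt_sub_sum_le (by simpa using hc) 5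
  rw [norm_pow, Real.norm_eq_abs, Real.norm_eq_abs]
  convert h using 3
  norm_num [Finset.sum_range_succ, Nat.factorial]
  ring

lemma exp_sub_sum_isBigO (n : ℕ) (hn : 0 < n) :
    (fun x : ℝ => exp x - ∑ m ∈ Finset.range n, x ^ m / m.factorial) =O[𝓝 0] fun x => x ^ n := by
  refine IsBigO.of_bound (n.succ / (n.factorial * n)) ?_
  filter_upwards [Metric.closedBall_mem_nhds (0 : ℝ) one_pos] with x hx
  rw [norm_pow, Real.norm_eq_abs, Real.norm_eq_abs, mul_comm]
  exact exp_bound (by simpa using hx) hn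

lemma exp_sub_taylor_isBigO :
    (fun x : ℝ => exp x - (1 + x + x ^ 2 / 2 + x ^ 3 / 6 + x ^ 4 / 24)) =O[𝓝 0]
      fun x => x ^ 5 := by
  refine (exp_sub_sum_isBigO 5 (by norm_num)).congr_left fun x => ?_
  norm_num [Finset.sum_range_succ, Nat.factorial]

lemma exp_neg_sub_taylor_isBigO :
    (fun x : ℝ => exp (-x) - (1 - x + x ^ 2 / 2 - x ^ 3 / 6 + x ^ 4 / 24)) =O[𝓝 0]
      fun x => x ^ 5 := by
  have ht : Tendsto (fun x : ℝ => -x) (𝓝 0) (𝓝 0) := by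
    simpa using (continuous_neg (G := ℝ)).tendsto 0
  refine ((exp_sub_taylor_isBigO.comp_tendsto ht).congr_left fun x => ?_).trans
    (IsBigO.of_bound 1 (Eventually.of_forall fun x => by simp))
  simp only [Function.comp_apply]
  ring

lemma exists_sinhcSqrt_eq_exp {δ : ℝ} (hδ : |δ| ≤ 1 / 20000) :
    ∃ c : ℝ, |c| ≤ 20 * |δ| ∧ sinhcSqrt c = exp δ := by
  set a := 20 * |δ| with ha
  have ha0 : 0 ≤ a := by positivity
  have ha1 : a ≤ 1 / 1000 := by linarith
  have hlin : ∀ c : ℝ, |c| ≤ a → |sinhcSqrt c - (1 + c / 6)| ≤ 3 * |c| ^ 2 := fun c hc => by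
    have := abs_sinhcSqrt_sub_sum_le (hc.trans (by linarith)) 2
    convert this using 3
    norm_num [Finset.sum_range_succ, Nat.factorial]
    ring
  have hr := abs_le.1 (hlin a (abs_of_nonneg ha0).le)
  have hl := abs_le.1 (hlin (-a) (by rw [abs_neg, abs_of_nonneg ha0]))
  rw [abs_neg] at hl
  rw [abs_of_nonneg ha0] at hr hl
  have he := abs_le.1 (abs_exp_sub_one_le (hδ.trans (by norm_num)))
  have hmem : exp δ ∈ Set.Icc (sinhcSqrt (-a)) (sinhcSqrt a) := by
    constructor <;> nlinarith [hr.1, hl.2, he.1, he.2]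
  obtain ⟨c, hc, hcδ⟩ := intermediate_value_Icc (by linarith)
    (continuousOn_sinhcSqrt.mono (Set.Icc_subset_Icc (by linarith) (by linarith))) hmem
  exact ⟨c, abs_le.2 hc, hcδ⟩

lemma pow_mul_isBigO_pow {R : ℝ → ℝ} (hR : Continuous R) (n : ℕ) :
    (fun x => x ^ n * R x) =O[𝓝 0] fun x : ℝ => x ^ n := by
  simpa using (isBigO_refl (fun x : ℝ => x ^ n) (𝓝 0)).mul ((hR.tendsto 0).isBigO_one ℝ)

lemma sub_inverse_taylor_isBigO {c : ℝ → ℝ} (hc : c =O[𝓝 0] fun x => x)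
    (hcx : ∀ᶠ x in 𝓝 0, sinhcSqrt (c x) = exp x) :
    (fun x => c x - (6 * x + 6 / 5 * x ^ 2 + 4 / 175 * x ^ 3 - 2 / 175 * x ^ 4)) =O[𝓝 0]
      fun x => x ^ 5 := by
  have hc0 : Tendsto c (𝓝 0) (𝓝 0) := hc.trans_tendsto tendsto_id
  set q : ℝ → ℝ := fun x => 6 * x + 6 / 5 * x ^ 2 + 4 / 175 * x ^ 3 - 2 / 175 * x ^ 4 with hq
  have hq0 : Tendsto q (𝓝 0) (𝓝 0) := by
    have : Continuous q := by fun_prop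
    simpa [hq] using this.tendsto 0
  set D : ℝ → ℝ := fun x => 1 / 6 + (c x + q x) / 120
    + (c x ^ 2 + c x * q x + q x ^ 2) / 5040
    + (c x ^ 3 + c x ^ 2 * q x + c x * q x ^ 2 + q x ^ 3) / 362880 with hD
  have hD0 : Tendsto D (𝓝 0) (𝓝 (1 / 6)) := by
    have : Tendsto D (𝓝 0) (𝓝 (1 / 6 + (0 + 0) / 120 + ((0 : ℝ) ^ 2 + 0 * 0 + 0 ^ 2) / 5040
        + ((0 : ℝ) ^ 3 + 0 ^ 2 * 0 + 0 * 0 ^ 2 + 0 ^ 3) / 362880)) :=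
      ((tendsto_const_nhds.add ((hc0.add hq0).div_const _)).add
        ((((hc0.pow 2).add (hc0.mul hq0)).add (hq0.pow 2)).div_const _)).add
        (((((hc0.pow 3).add ((hc0.pow 2).mul hq0)).add (hc0.mul (hq0.pow 2))).add
          (hq0.pow 3)).div_const _)
    simpa using this
  have h1 := (sinhcSqrt_sub_taylor_isBigO.comp_tendsto hc0).trans (hc.pow 5)
  have h3 : (fun x => (1 + q x / 6 + q x ^ 2 / 120 + q x ^ 3 / 5040 + q x ^ 4 / 362880)
      - (1 + x + x ^ 2 / 2 + x ^ 3 / 6 + x ^ 4 / 24)) =O[𝓝 0] fun x => x ^ 5 := by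
    refine (pow_mul_isBigO_pow (R := fun x => 239 / 30625 + 601 / 612500 * x + 1 / 25725 * x ^ 2 - 599 / 42875000 * x ^ 3 - 4931 /
        1688203125 * x ^ 4 - 467 / 2894062500 * x ^ 5 + 983 / 50646093750 * x ^ 6 +
        33713 / 10635679687500 * x ^ 7 + 97 / 5317839843750 * x ^ 8 - 11 /
        590871093750 * x ^ 9 - 1 / 2658919921875 * x ^ 10 + 1 / 21271359375000 * x ^
        11) (by fun_prop) 5).congr_left fun x => ?_
    simp only [hq]
    ring
  have h4 : (fun x => (c x - q x) * D x) =O[𝓝 0] fun x => x ^ 5 := by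
    refine ((exp_sub_taylor_isBigO.sub h1).sub h3).congr' ?_ EventuallyEq.rfl
    filter_upwards [hcx] with x hx
    simp only [Function.comp_apply, hx, hD]
    ring
  have h5 : (fun x => (D x)⁻¹) =O[𝓝 0] fun _ => (1 : ℝ) :=
    (hD0.inv₀ (by norm_num)).isBigO_one ℝ
  refine (h4.mul h5).congr' ?_ (Eventually.of_forall fun x => by simp)
  filter_upwards [hD0.eventually_ne (by norm_num : (1 / 6 : ℝ) ≠ 0)] with x hx
  rw [mul_assoc, mul_inv_cancel₀ hx, mul_one]

lemma diagonal_taylor_isBigO {c : ℝ → ℝ} (hc : c =O[𝓝 0] fun x => x)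
    (hcx : ∀ᶠ x in 𝓝 0, sinhcSqrt (c x) = exp x) :
    (fun x => 4 * c x + 8 * exp (-x) * (1 - coshSqrt (c x))
      - (12 * x ^ 2 - 12 / 5 * x ^ 3 + 109 / 175 * x ^ 4)) =O[𝓝 0] fun x => x ^ 5 := by
  have hc0 : Tendsto c (𝓝 0) (𝓝 0) := hc.trans_tendsto tendsto_id
  have hcq := sub_inverse_taylor_isBigO hc hcx
  set q : ℝ → ℝ := fun x => 6 * x + 6 / 5 * x ^ 2 + 4 / 175 * x ^ 3 - 2 / 175 * x ^ 4 with hq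
  have hq0 : Tendsto q (𝓝 0) (𝓝 0) := by
    have : Continuous q := by fun_prop
    simpa [hq] using this.tendsto 0
  set m : ℝ → ℝ := fun x => 1 - x + x ^ 2 / 2 - x ^ 3 / 6 + x ^ 4 / 24 with hm
  have hmO : m =O[𝓝 0] fun _ => (1 : ℝ) :=
    ((by fun_prop : Continuous m).tendsto 0).isBigO_one ℝ
  set D : ℝ → ℝ := fun x => 1 / 2 + (c x + q x) / 24
    + (c x ^ 2 + c x * q x + q x ^ 2) / 720
    + (c x ^ 3 + c x ^ 2 * q x + c x * q x ^ 2 + q x ^ 3) / 40320 with hD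
  have hDO : D =O[𝓝 0] fun _ => (1 : ℝ) :=
    (((tendsto_const_nhds.add ((hc0.add hq0).div_const _)).add
      ((((hc0.pow 2).add (hc0.mul hq0)).add (hq0.pow 2)).div_const _)).add
      (((((hc0.pow 3).add ((hc0.pow 2).mul hq0)).add (hc0.mul (hq0.pow 2))).add
        (hq0.pow 3)).div_const _)).isBigO_one ℝ
  have hC := (coshSqrt_sub_taylor_isBigO.comp_tendsto hc0).trans (hc.pow 5)
  have hCO : (fun x => 1 - coshSqrt (c x)) =O[𝓝 0] fun _ => (1 : ℝ) := by
    have hsum : Continuous fun c : ℝ => c / 2 + c ^ 2 / 24 + c ^ 3 / 720 + c ^ 4 / 40320 := by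
      fun_prop
    have h5 : (fun x : ℝ => x ^ 5) =O[𝓝 0] fun _ => (1 : ℝ) :=
      ((continuous_pow 5).tendsto (0 : ℝ)).isBigO_one ℝ
    refine ((hC.trans h5).neg_left.sub (((hsum.tendsto 0).comp hc0).isBigO_one ℝ)).congr_left
      fun x => ?_
    simp only [Function.comp_apply]
    ring
  have hrem : (fun x => 4 * q x
      + 8 * m x * (1 - (1 + q x / 2 + q x ^ 2 / 24 + q x ^ 3 / 720 + q x ^ 4 / 40320))
      - (12 * x ^ 2 - 12 / 5 * x ^ 3 + 109 / 175 * x ^ 4)) =O[𝓝 0] fun x => x ^ 5 := by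
    refine (pow_mul_isBigO_pow (R := fun x => -102 / 875 - 16133 / 91875 * x - 51097 / 459375 * x ^ 2 - 5385733 / 128625000 * x ^ 3
        - 2680372 / 241171875 * x ^ 4 - 4775899 / 2250937500 * x ^ 5 - 3803237 /
        16882031250 * x ^ 6 + 58111691 / 7090453125000 * x ^ 7 + 5493149 /
        886306640625 * x ^ 8 + 777899 / 1181742187500 * x ^ 9 - 11927 / 590871093750 *
        x ^ 10 - 31369 / 3545226562500 * x ^ 11 - 463 / 1772613281250 * x ^ 12 + 44 /
        886306640625 * x ^ 13 + 1 / 590871093750 * x ^ 14 - 1 / 7090453125000 * x ^ 15) (by fun_prop) 5).congr_left fun x => ?_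
    simp only [hq, hm]
    ring
  have t1 : (fun x => (exp (-x) - m x) * (1 - coshSqrt (c x))) =O[𝓝 0] fun x => x ^ 5 := by
    simpa using exp_neg_sub_taylor_isBigO.mul hCO
  have t2 := hmO.mul hC
  have t3 := (hmO.mul hDO).mul hcq
  simp only [one_mul] at t2 t3
  refine (((((hcq.const_mul_left 4).add (t1.const_mul_left 8)).sub (t2.const_mul_left 8)).sub
    (t3.const_mul_left 8)).add hrem).congr_left fun x => ?_
  simp only [Function.comp_apply, hD]
  ring

lemma exists_local_inverse_sinhcSqrt :
    ∃ c : ℝ → ℝ, c =O[𝓝 0] (fun x => x) ∧ ∀ᶠ x in 𝓝 0, sinhcSqrt (c x) = exp x := by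
  choose! c hc hcx using fun (x : ℝ) (hx : |x| ≤ 1 / 20000) => exists_sinhcSqrt_eq_exp hx
  have hball : ∀ᶠ x : ℝ in 𝓝 0, |x| ≤ 1 / 20000 := by
    filter_upwards [Metric.closedBall_mem_nhds (0 : ℝ) (by norm_num : (0 : ℝ) < 1 / 20000)]
      with x hx
    simpa using hx
  exact ⟨c, IsBigO.of_bound 20 (hball.mono hc), hball.mono hcx⟩

lemma cosh_sub_taylor_isBigO :
    (fun x : ℝ => cosh x - (1 + x ^ 2 / 2 + x ^ 4 / 24)) =O[𝓝 0] fun x => x ^ 5 := by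
  have ht : Tendsto (fun x : ℝ => x ^ 2) (𝓝 0) (𝓝 0) := by
    simpa using (continuous_pow 2).tendsto (0 : ℝ)
  have h10 : (fun x : ℝ => (x ^ 2) ^ 5) =O[𝓝 0] fun x => x ^ 5 :=
    (pow_mul_isBigO_pow (continuous_pow 5) 5).congr_left fun x => by ring
  refine (((coshSqrt_sub_taylor_isBigO.comp_tendsto ht).trans h10).add
    (pow_mul_isBigO_pow (R := fun x => x / 720 + x ^ 3 / 40320) (by fun_prop) 5)).congr_left
    fun x => ?_
  simp only [Function.comp_apply, coshSqrt_sq]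
  ring

lemma cosh_sub_one_isBigO : (fun x : ℝ => cosh x - 1) =O[𝓝 0] fun x => x ^ 2 := by
  have h5 : (fun x : ℝ => x ^ 5) =O[𝓝 0] fun x => x ^ 2 :=
    (pow_mul_isBigO_pow (continuous_pow 3) 2).congr_left fun x => by ring
  refine ((cosh_sub_taylor_isBigO.trans h5).add
    (pow_mul_isBigO_pow (R := fun x => 1 / 2 + x ^ 2 / 24) (by fun_prop) 2)).congr_left
    fun x => ?_
  ring

lemma exp_neg_sub_quadratic_isBigO :
    (fun x : ℝ => exp (-x) - (1 - x + x ^ 2 / 2)) =O[𝓝 0] fun x => x ^ 3 := by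
  have h5 : (fun x : ℝ => x ^ 5) =O[𝓝 0] fun x => x ^ 3 :=
    (pow_mul_isBigO_pow (continuous_pow 2) 3).congr_left fun x => by ring
  refine ((exp_neg_sub_taylor_isBigO.trans h5).add
    (pow_mul_isBigO_pow (R := fun x => -1 / 6 + x / 24) (by fun_prop) 3)).congr_left
    fun x => ?_
  ring

lemma eventually_ratefun_eq {c : ℝ → ℝ} (hc : c =O[𝓝 0] fun x => x)
    (hcx : ∀ᶠ x in 𝓝 0, sinhcSqrt (c x) = exp x) :
    ∀ᶠ p : ℝ × ℝ in 𝓝 (0, 0), ratefun (exp p.1) (exp p.2) = 4 * c (p.1 - p.2)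
      + 8 * exp (-(p.1 - p.2)) * (cosh p.2 - coshSqrt (c (p.1 - p.2))) := by
  have hd : Tendsto (fun p : ℝ × ℝ => p.1 - p.2) (𝓝 (0, 0)) (𝓝 0) :=
    (continuous_fst.sub continuous_snd).tendsto' _ _ (sub_self 0)
  have hs : Tendsto (fun p : ℝ × ℝ => p.2) (𝓝 (0, 0)) (𝓝 0) := by
    simpa using continuous_snd.tendsto ((0, 0) : ℝ × ℝ)
  have hball : ∀ᶠ x : ℝ in 𝓝 0, |x| ≤ 1 / 1000 := by
    filter_upwards [Metric.closedBall_mem_nhds (0 : ℝ) (by norm_num : (0 : ℝ) < 1 / 1000)]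
      with x hx
    simpa using hx
  have hc0 : Tendsto c (𝓝 0) (𝓝 0) := hc.trans_tendsto tendsto_id
  filter_upwards [hd.eventually hcx, hd.eventually (hc0.eventually hball), hs.eventually hball]
    with p h1 h2 h3
  have h := ratefun_sinhcSqrt_mul_exp h2 h3
  rw [h1, ← exp_add, sub_add_cancel] at h
  rw [h, exp_neg]
  ring

lemma ratefun_sub_quartic_isBigO :
    (fun p : ℝ × ℝ => ratefun (exp p.1) (exp p.2)
      - (12 * (p.1 - p.2) ^ 2 - 12 / 5 * (p.1 - p.2) ^ 3 + 109 / 175 * (p.1 - p.2) ^ 4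
        + 4 * p.2 ^ 2 * (1 - (p.1 - p.2) + (p.1 - p.2) ^ 2 / 2) + p.2 ^ 4 / 3))
      =O[𝓝 (0, 0)] fun p => ‖p‖ ^ 5 := by
  obtain ⟨c, hc, hcx⟩ := exists_local_inverse_sinhcSqrt
  have hd : Tendsto (fun p : ℝ × ℝ => p.1 - p.2) (𝓝 (0, 0)) (𝓝 0) :=
    (continuous_fst.sub continuous_snd).tendsto' _ _ (sub_self 0)
  have hs : Tendsto (fun p : ℝ × ℝ => p.2) (𝓝 (0, 0)) (𝓝 0) := by
    simpa using continuous_snd.tendsto ((0, 0) : ℝ × ℝ)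
  have hsO : (fun p : ℝ × ℝ => p.2) =O[𝓝 (0, 0)] fun p => ‖p‖ := isBigO_snd_prod'.norm_right
  have hdO : (fun p : ℝ × ℝ => p.1 - p.2) =O[𝓝 (0, 0)] fun p => ‖p‖ :=
    isBigO_fst_prod'.norm_right.sub hsO
  have t1 := ((diagonal_taylor_isBigO hc hcx).comp_tendsto hd).trans (hdO.pow 5)
  have t2 := (((exp_neg_sub_quadratic_isBigO.comp_tendsto hd).trans (hdO.pow 3)).mul
    ((cosh_sub_one_isBigO.comp_tendsto hs).trans (hsO.pow 2))).congr_right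
    (g₂ := fun p : ℝ × ℝ => ‖p‖ ^ 5) fun p => by ring
  have hcont : Continuous fun x : ℝ => 1 - x + x ^ 2 / 2 := by fun_prop
  have hcont' : Continuous fun x : ℝ => -1 + x / 2 := by fun_prop
  have t3 := (((hcont.tendsto 0).comp hd).isBigO_one ℝ).mul
    ((cosh_sub_taylor_isBigO.comp_tendsto hs).trans (hsO.pow 5))
  have t4 := (((hcont'.tendsto 0).comp hd).isBigO_one ℝ).mul
    ((hdO.mul (hsO.pow 4)).congr_right (g₂ := fun p : ℝ × ℝ => ‖p‖ ^ 5) fun p => by ring)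
  simp only [one_mul] at t3 t4
  refine (((t1.add (t2.const_mul_left 8)).add (t3.const_mul_left 8)).add
    (t4.const_mul_left (1 / 3))).congr' ?_ EventuallyEq.rfl
  filter_upwards [eventually_ratefun_eq hc hcx] with p hp
  simp only [Function.comp_apply]
  rw [hp]
  ring

/-- Quartic Taylor expansion of the rate function `I(e^ε, e^η)` around `(ε,η) = (0,0)`:
`I(e^ε,e^η) = P(ε,η) + o((ε²+η²)²)` where `P` is the explicit quartic polynomial. -/
theorem ratefun_quartic_expansion
    (P : ℝ → ℝ → ℝ)
    (hP : ∀ ε η : ℝ, P ε η =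
      12 * ε ^ 2 - 24 * ε * η + 16 * η ^ 2
        - (12 / 5) * ε ^ 3 + (36 / 5) * ε ^ 2 * η - (56 / 5) * ε * η ^ 2 + (32 / 5) * η ^ 3
        + (109 / 175) * ε ^ 4 - (436 / 175) * ε ^ 3 * η + (1004 / 175) * ε ^ 2 * η ^ 2
        - (1136 / 175) * ε * η ^ 3 + (1552 / 525) * η ^ 4) :
    Filter.Tendsto
      (fun p : ℝ × ℝ =>
        (ratefun (Real.exp p.1) (Real.exp p.2) - P p.1 p.2) / (p.1 ^ 2 + p.2 ^ 2) ^ 2)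
      (nhdsWithin (0, 0) {p : ℝ × ℝ | p ≠ (0, 0)})
      (nhds 0) := by

  have h45 : (fun p : ℝ × ℝ => ‖p‖ ^ 5) =o[𝓝 (0, 0)] fun p => ‖p‖ ^ 4 := by
    have h1 : (fun p : ℝ × ℝ => ‖p‖) =o[𝓝 (0, 0)] fun _ => (1 : ℝ) :=
      (isLittleO_one_iff ℝ).2 (by simpa using continuous_norm.tendsto ((0, 0) : ℝ × ℝ))
    exact ((isBigO_refl (fun p : ℝ × ℝ => ‖p‖ ^ 4) (𝓝 (0, 0))).mul_isLittleO h1).congr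
      (fun p => (pow_succ _ 4).symm) fun p => mul_one _
  have h4 : (fun p : ℝ × ℝ => ‖p‖ ^ 4) =O[𝓝 (0, 0)] fun p => (p.1 ^ 2 + p.2 ^ 2) ^ 2 := by
    refine IsBigO.of_bound 1 (Eventually.of_forall fun p => ?_)
    have hsq : ‖p‖ ^ 2 ≤ p.1 ^ 2 + p.2 ^ 2 := by
      rcases max_choice ‖p.1‖ ‖p.2‖ with h | h <;>
        rw [Prod.norm_def, h, Real.norm_eq_abs, sq_abs] <;>
        nlinarith [sq_nonneg p.1, sq_nonneg p.2]
    rw [Real.norm_of_nonneg (by positivity), Real.norm_of_nonneg (by positivity), one_mul]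
    calc ‖p‖ ^ 4 = (‖p‖ ^ 2) ^ 2 := by ring
      _ ≤ _ := by gcongr
  have h := (ratefun_sub_quartic_isBigO.trans_isLittleO h45).trans_isBigO h4
  refine (h.tendsto_div_nhds_zero.mono_left nhdsWithin_le_nhds).congr fun p => ?_
  rw [hP]
  ring
end

section
/- Let a > 0 and ϱ ∈ (−1, 1). Then the rate function J_X(y; a, ϱ) has the quadratic behavior lim_{y → −1/2} J_X(y; a, ϱ)/(y + 1/2)² = 6a/(6 + a − 3√(2a)·ϱ) at its minimum point y = −1/2. -/
open MeasureTheory ProbabilityTheory Filter Real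

/-- Cauchy–Schwarz for interval integrals against a continuous weight. -/
lemma sq_integral_mul_le {a b : ℝ} (hab : a ≤ b) {h g : ℝ → ℝ} (hh : Continuous h)
    (hg : IntervalIntegrable g volume a b)
    (hg2 : IntervalIntegrable (fun z => g z ^ 2) volume a b)
    (hpos : 0 < ∫ z in a..b, h z ^ 2) :
    (∫ z in a..b, h z * g z) ^ 2 ≤ (∫ z in a..b, h z ^ 2) * ∫ z in a..b, g z ^ 2 := by
  set H := ∫ z in a..b, h z ^ 2
  set S := ∫ z in a..b, h z * g z
  have hhg : IntervalIntegrable (fun z => h z * g z) volume a b :=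
    hg.continuousOn_mul hh.continuousOn
  have hh2 : IntervalIntegrable (fun z => h z ^ 2) volume a b :=
    (hh.pow 2).intervalIntegrable _ _
  have key : 0 ≤ ∫ z in a..b, (H * g z - S * h z) ^ 2 :=
    intervalIntegral.integral_nonneg hab fun z _ => sq_nonneg _
  have expand : ∫ z in a..b, (H * g z - S * h z) ^ 2
      = H ^ 2 * (∫ z in a..b, g z ^ 2) - 2 * H * S * S + S ^ 2 * H := by
    calc ∫ z in a..b, (H * g z - S * h z) ^ 2
        = ∫ z in a..b, (H ^ 2 * g z ^ 2 - 2 * H * S * (h z * g z) + S ^ 2 * h z ^ 2) :=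
          intervalIntegral.integral_congr fun z _ => by ring
      _ = _ := by
          rw [intervalIntegral.integral_add ((hg2.const_mul _).sub (hhg.const_mul _))
              (hh2.const_mul _),
            intervalIntegral.integral_sub (hg2.const_mul _) (hhg.const_mul _),
            intervalIntegral.integral_const_mul, intervalIntegral.integral_const_mul,
            intervalIntegral.integral_const_mul]
  rw [expand] at key
  refine le_of_mul_le_mul_left ?_ hpos
  nlinarith

/-- A primitive vanishing at `0` is controlled on `[0,1]` by the `L²` norm of its derivative. -/
lemma abs_primitive_le {g : ℝ → ℝ} {n z : ℝ} (hg : IntervalIntegrable g volume 0 1)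
    (hg2 : IntervalIntegrable (fun z => g z ^ 2) volume 0 1) (hn : 0 ≤ n)
    (hgn : ∫ z in (0:ℝ)..1, g z ^ 2 ≤ n ^ 2) (hz : z ∈ Set.Icc (0:ℝ) 1) :
    |∫ t in (0:ℝ)..z, g t| ≤ n := by
  rcases hz.1.eq_or_lt with rfl | hz0
  · simpa using hn
  have hsub : Set.uIcc 0 z ⊆ Set.uIcc (0:ℝ) 1 := by
    rw [Set.uIcc_of_le hz.1, Set.uIcc_of_le zero_le_one]
    exact Set.Icc_subset_Icc_right hz.2
  have hsub' : Set.uIcc z 1 ⊆ Set.uIcc (0:ℝ) 1 := by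
    rw [Set.uIcc_of_le hz.2, Set.uIcc_of_le zero_le_one]
    exact Set.Icc_subset_Icc_left hz.1
  have cs := sq_integral_mul_le hz.1 (h := fun _ => (1:ℝ)) continuous_const (hg.mono_set hsub)
    (hg2.mono_set hsub) (by simpa using hz0)
  simp only [one_pow, one_mul, intervalIntegral.integral_const, smul_eq_mul, mul_one,
    sub_zero] at cs
  have hadd := intervalIntegral.integral_add_adjacent_intervals (hg2.mono_set hsub)
    (hg2.mono_set hsub')
  have h0 : 0 ≤ ∫ t in (0:ℝ)..z, g t ^ 2 :=
    intervalIntegral.integral_nonneg hz.1 fun _ _ => sq_nonneg _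
  have h1 : 0 ≤ ∫ t in z..1, g t ^ 2 :=
    intervalIntegral.integral_nonneg hz.2 fun _ _ => sq_nonneg _
  refine abs_le_of_sq_le_sq ?_ hn
  nlinarith [hz.2]

lemma continuousOn_primitive_unit {g : ℝ → ℝ} (hg : IntervalIntegrable g volume 0 1) :
    ContinuousOn (fun z => ∫ t in (0:ℝ)..z, g t) (Set.uIcc 0 1) :=
  intervalIntegral.continuousOn_primitive_interval' hg (by simp)

/-- Integration by parts for the average of a primitive. -/
lemma integral_primitive_eq {g : ℝ → ℝ} (hg : IntervalIntegrable g volume 0 1) :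
    ∫ z in (0:ℝ)..1, ∫ t in (0:ℝ)..z, g t = ∫ z in (0:ℝ)..1, (1 - z) * g z := by
  have hF := hg.absolutelyContinuousOnInterval_intervalIntegral (c := 0) (by simp)
  have hl : AbsolutelyContinuousOnInterval (fun z : ℝ => 1 - z) 0 1 :=
    ContDiffOn.absolutelyContinuousOnInterval (by fun_prop)
  have key := hl.integral_mul_deriv_eq_deriv_mul hF
  have hd : ∀ z : ℝ, deriv (fun z : ℝ => 1 - z) z = -1 := fun z => by simp
  simp only [hd, neg_mul, one_mul, intervalIntegral.integral_neg, sub_self, zero_mul,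
    intervalIntegral.integral_same, mul_zero, zero_sub, neg_neg] at key
  rw [← key]
  refine intervalIntegral.integral_congr_ae ?_
  filter_upwards [hg.ae_hasDerivAt_integral] with z hz hz'
  rw [(hz (Set.uIoc_subset_uIcc hz') 0 (by simp)).deriv]

/-- First-order expansion of `(∫ e^{2f}, e^{f(1)})` around `f = 0`, with quadratic error. -/
lemma exp_functional_expansion {g : ℝ → ℝ} {n : ℝ} (c : ℝ)
    (hg : IntervalIntegrable g volume 0 1)
    (hg2 : IntervalIntegrable (fun z => g z ^ 2) volume 0 1) (hn : 0 ≤ n) (hn' : n ≤ 1 / 2)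
    (hgn : ∫ z in (0:ℝ)..1, g z ^ 2 ≤ n ^ 2) :
    |(∫ z in (0:ℝ)..1, exp (2 * ∫ t in (0:ℝ)..z, g t)) - 1| ≤ 2 * n + 4 * n ^ 2 ∧
    |((∫ z in (0:ℝ)..1, exp (2 * ∫ t in (0:ℝ)..z, g t)) - 1) / 2
        - c * (exp (∫ t in (0:ℝ)..1, g t) - 1)
        - ∫ z in (0:ℝ)..1, (1 - z - c) * g z| ≤ (2 + |c|) * n ^ 2 := by
  have hF := continuousOn_primitive_unit hg
  have hFi : IntervalIntegrable (fun z => ∫ t in (0:ℝ)..z, g t) volume 0 1 :=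
    hF.intervalIntegrable
  have hEi : IntervalIntegrable (fun z => exp (2 * ∫ t in (0:ℝ)..z, g t)) volume 0 1 :=
    (continuous_exp.comp_continuousOn (hF.const_smul (2:ℝ))).intervalIntegrable
  have hb : ∀ z ∈ Set.Icc (0:ℝ) 1, |∫ t in (0:ℝ)..z, g t| ≤ n := fun z hz =>
    abs_primitive_le hg hg2 hn hgn hz
  set E := ∫ z in (0:ℝ)..1, exp (2 * ∫ t in (0:ℝ)..z, g t)
  set P := ∫ z in (0:ℝ)..1, ∫ t in (0:ℝ)..z, g t
  set Q := ∫ t in (0:ℝ)..1, g t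
  have hP : |P| ≤ n := by
    have := intervalIntegral.norm_integral_le_of_norm_le_const (a := 0) (b := 1) (C := n)
      (f := fun z => ∫ t in (0:ℝ)..z, g t) fun z hz => hb z (by
        rw [Set.uIoc_of_le zero_le_one] at hz; exact ⟨hz.1.le, hz.2⟩)
    simpa using this
  have hE : |E - 1 - 2 * P| ≤ 4 * n ^ 2 := by
    have h1 : E - 1 - 2 * P = ∫ z in (0:ℝ)..1,
        (exp (2 * ∫ t in (0:ℝ)..z, g t) - 1 - 2 * ∫ t in (0:ℝ)..z, g t) := by
      rw [intervalIntegral.integral_sub (hEi.sub (by simp)) (hFi.const_mul _),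
        intervalIntegral.integral_sub hEi (by simp), intervalIntegral.integral_const_mul]
      simp [E, P]
    rw [h1]
    have := intervalIntegral.norm_integral_le_of_norm_le_const (a := 0) (b := 1) (C := 4 * n ^ 2)
      (f := fun z => exp (2 * ∫ t in (0:ℝ)..z, g t) - 1 - 2 * ∫ t in (0:ℝ)..z, g t)
      fun z hz => by
        rw [Set.uIoc_of_le zero_le_one] at hz
        have hz' := hb z ⟨hz.1.le, hz.2⟩
        have h2 : |2 * ∫ t in (0:ℝ)..z, g t| ≤ 2 * n := by
          rw [abs_mul, abs_two]; linarith
        refine (abs_exp_sub_one_sub_id_le (h2.trans (by linarith))).trans ?_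
        rw [← sq_abs]
        nlinarith [abs_nonneg (2 * ∫ t in (0:ℝ)..z, g t)]
    simpa using this
  have hQ : |exp Q - 1 - Q| ≤ n ^ 2 := by
    have hQn : |Q| ≤ n := hb 1 (by simp)
    refine (abs_exp_sub_one_sub_id_le (hQn.trans (by linarith))).trans ?_
    rw [← sq_abs]
    nlinarith [abs_nonneg Q]
  have hS : ∫ z in (0:ℝ)..1, (1 - z - c) * g z = P - c * Q := by
    have h1g : IntervalIntegrable (fun z => (1 - z) * g z) volume 0 1 :=
      hg.continuousOn_mul (by fun_prop)
    simp only [P, Q, integral_primitive_eq hg]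
    rw [← intervalIntegral.integral_const_mul, ← intervalIntegral.integral_sub h1g
      (hg.const_mul _)]
    exact intervalIntegral.integral_congr fun z _ => by ring
  constructor
  · have : E - 1 = (E - 1 - 2 * P) + 2 * P := by ring
    rw [this]
    refine (abs_add_le _ _).trans ?_
    rw [abs_mul, abs_two]
    linarith
  · rw [hS]
    have : (E - 1) / 2 - c * (exp Q - 1) - (P - c * Q)
        = (E - 1 - 2 * P) / 2 - c * (exp Q - 1 - Q) := by ring
    rw [this]
    refine (abs_sub _ _).trans ?_
    rw [abs_mul, abs_div, abs_two]
    nlinarith [abs_nonneg c]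

/-- The constraint set of `ratefun u v` is nonempty: every `u, v > 0` is attained. -/
lemma exists_ratefun_constraint {u v : ℝ} (hu : 0 < u) (hv : 0 < v) :
    ∃ g : ℝ → ℝ, IntervalIntegrable g volume 0 1 ∧
      IntervalIntegrable (fun z => g z ^ 2) volume 0 1 ∧
      (∫ z in (0:ℝ)..1, exp (2 * ∫ t in (0:ℝ)..z, g t)) = u ∧
      exp (∫ t in (0:ℝ)..1, g t) = v := by
  set l := log v
  have hprim : ∀ c z : ℝ, ∫ t in (0:ℝ)..z, (l + c * (1 - 2 * t)) = l * z + c * (z - z ^ 2) := by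
    intro c z
    rw [intervalIntegral.integral_eq_sub_of_hasDerivAt
      (f := fun z => l * z + c * (z - z ^ 2))]
    · simp
    · intro x _
      have := ((hasDerivAt_id x).const_mul l).add
        (((hasDerivAt_id x).sub ((hasDerivAt_id x).pow 2)).const_mul c)
      convert! this using 1
      simp
    · exact Continuous.intervalIntegrable (by fun_prop) _ _
  let Φ : ℝ → ℝ := fun c => ∫ z in (0:ℝ)..1, exp (2 * (l * z + c * (z - z ^ 2)))
  have hΦ : Continuous Φ :=
    intervalIntegral.continuous_parametric_intervalIntegral_of_continuous' (by fun_prop) _ _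
  have hlow : ∃ c, Φ c ≤ u := by
    have hlim : Tendsto (fun k : ℝ => Φ (-k)) atTop (nhds 0) := by
      have h0 : (0:ℝ) = ∫ z in (0:ℝ)..1, (0:ℝ) := by simp
      rw [h0]
      refine intervalIntegral.tendsto_integral_filter_of_dominated_convergence
        (fun _ => exp (2 * |l|)) (Eventually.of_forall fun k => ?_) ?_ (by simp) ?_
      · exact Continuous.aestronglyMeasurable (by fun_prop)
      · filter_upwards [eventually_ge_atTop 0] with k hk
        refine Eventually.of_forall fun z hz => ?_
        rw [Set.uIoc_of_le zero_le_one] at hz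
        rw [norm_eq_abs, abs_exp, exp_le_exp]
        have h1 : l * z ≤ |l| := by
          nlinarith [le_abs_self l, abs_nonneg l, hz.1, hz.2,
            mul_le_mul_of_nonneg_right (le_abs_self l) hz.1.le]
        have h2 : 0 ≤ k * (z - z ^ 2) := mul_nonneg hk (by nlinarith [hz.1, hz.2])
        linarith
      · have hne : ∀ᵐ z : ℝ, z ≠ 1 := by
          simp [ae_iff]
        filter_upwards [hne] with z hz1 hz
        rw [Set.uIoc_of_le zero_le_one] at hz
        have hw : 0 < z - z ^ 2 := by
          have : z < 1 := lt_of_le_of_ne hz.2 hz1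
          nlinarith [hz.1]
        refine tendsto_exp_atBot.comp ?_
        have : Tendsto (fun k : ℝ => 2 * (l * z) + -(2 * (z - z ^ 2)) * k) atTop atBot :=
          tendsto_atBot_add_const_left _ _
            (tendsto_id.const_mul_atTop_of_neg (by linarith))
        refine this.congr fun k => by ring
    obtain ⟨k, hk⟩ := (hlim.eventually (gt_mem_nhds hu)).exists
    exact ⟨-k, hk.le⟩
  have hhigh : ∃ c, u ≤ Φ c := by
    refine ⟨3 * (u - 1 - l), ?_⟩
    have hint : ∫ z in (0:ℝ)..1, (1 + 2 * (l * z + 3 * (u - 1 - l) * (z - z ^ 2))) = u := by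
      rw [intervalIntegral.integral_eq_sub_of_hasDerivAt
        (f := fun z => z + l * z ^ 2 + 3 * (u - 1 - l) * (z ^ 2 - 2 / 3 * z ^ 3))]
      · ring
      · intro x _
        have := ((hasDerivAt_id x).add (((hasDerivAt_id x).pow 2).const_mul l)).add
          ((((hasDerivAt_id x).pow 2).sub
            (((hasDerivAt_id x).pow 3).const_mul (2 / 3))).const_mul (3 * (u - 1 - l)))
        convert! this using 1
        simp
        ring
      · exact Continuous.intervalIntegrable (by fun_prop) _ _
    rw [← hint]
    refine intervalIntegral.integral_mono_on zero_le_one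
      (Continuous.intervalIntegrable (by fun_prop) _ _)
      (Continuous.intervalIntegrable (by fun_prop) _ _) fun z _ => ?_
    rw [hint]
    linarith [add_one_le_exp (2 * (l * z + 3 * (u - 1 - l) * (z - z ^ 2)))]
  obtain ⟨c, hc⟩ := mem_range_of_exists_le_of_exists_ge hΦ hlow hhigh
  refine ⟨fun t => l + c * (1 - 2 * t), Continuous.intervalIntegrable (by fun_prop) _ _,
    Continuous.intervalIntegrable (by fun_prop) _ _, ?_, ?_⟩
  · simp only [hprim]
    exact hc
  · rw [hprim]
    simp [l, exp_log hv]

lemma ratefun_nonneg (u v : ℝ) : 0 ≤ ratefun u v := by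
  refine Real.sInf_nonneg ?_
  rintro r ⟨g, -, -, -, -, rfl⟩
  have : 0 ≤ ∫ z in (0:ℝ)..1, g z ^ 2 :=
    intervalIntegral.integral_nonneg zero_le_one fun _ _ => sq_nonneg _
  linarith

lemma ratefun_le {g : ℝ → ℝ} (hg : IntervalIntegrable g volume 0 1)
    (hg2 : IntervalIntegrable (fun z => g z ^ 2) volume 0 1) :
    ratefun (∫ z in (0:ℝ)..1, exp (2 * ∫ t in (0:ℝ)..z, g t)) (exp (∫ t in (0:ℝ)..1, g t))
      ≤ 4 * ∫ z in (0:ℝ)..1, g z ^ 2 := by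
  refine csInf_le ⟨0, ?_⟩ ⟨g, hg, hg2, rfl, rfl, rfl⟩
  rintro r ⟨g, -, -, -, -, rfl⟩
  have : 0 ≤ ∫ z in (0:ℝ)..1, g z ^ 2 :=
    intervalIntegral.integral_nonneg zero_le_one fun _ _ => sq_nonneg _
  linarith

lemma le_ratefun {u v b : ℝ} (hu : 0 < u) (hv : 0 < v)
    (h : ∀ g : ℝ → ℝ, IntervalIntegrable g volume 0 1 →
      IntervalIntegrable (fun z => g z ^ 2) volume 0 1 →
      (∫ z in (0:ℝ)..1, exp (2 * ∫ t in (0:ℝ)..z, g t)) = u →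
      exp (∫ t in (0:ℝ)..1, g t) = v → b ≤ 4 * ∫ z in (0:ℝ)..1, g z ^ 2) :
    b ≤ ratefun u v := by
  obtain ⟨g, h1, h2, h3, h4⟩ := exists_ratefun_constraint hu hv
  refine le_csInf ⟨_, g, h1, h2, h3, h4, rfl⟩ ?_
  rintro r ⟨g, h1, h2, h3, h4, rfl⟩
  exact h g h1 h2 h3 h4

lemma integral_affine_weight_sq (c : ℝ) :
    ∫ z in (0:ℝ)..1, (1 - z - c) ^ 2 = 1 / 3 - c + c ^ 2 := by
  rw [intervalIntegral.integral_eq_sub_of_hasDerivAt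
    (f := fun z => (1 - c) ^ 2 * z - (1 - c) * z ^ 2 + 1 / 3 * z ^ 3)]
  · ring
  · intro x _
    have := (((hasDerivAt_id x).const_mul ((1 - c) ^ 2)).sub
      (((hasDerivAt_id x).pow 2).const_mul (1 - c))).add
        (((hasDerivAt_id x).pow 3).const_mul (1 / 3))
    convert! this using 1
    simp
    ring
  · exact Continuous.intervalIntegrable (by fun_prop) _ _

lemma affine_weight_pos (c : ℝ) : 0 < 1 / 3 - c + c ^ 2 := by nlinarith [sq_nonneg (c - 1 / 2)]

/-- The finite-dimensional quadratic minimization underlying the limit. -/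
lemma quadratic_min_le {H B G x s : ℝ} (hH : 0 < H) (hB : 0 < B) (hs : s ^ 2 ≤ H * G) :
    2 * B / (2 + B * H) * x ^ 2 ≤ 2 * G + B * (x + s) ^ 2 := by
  have hBH : 0 < 2 + B * H := by positivity
  rw [div_mul_eq_mul_div, div_le_iff₀ hBH]
  refine le_of_mul_le_mul_left ?_ hH
  have h1 : 0 ≤ (2 * s + B * H * (x + s)) ^ 2 := sq_nonneg _
  have h2 : 0 ≤ (4 + 2 * B * H) * (H * G - s ^ 2) :=
    mul_nonneg (by positivity) (by linarith)
  nlinarith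

lemma rate_functional_lower {A c L m δ u v : ℝ} (hA : 0 < A) (hm : 0 ≤ m) (hL : L = 2 * m ^ 2)
    (hδ : m * |δ| ≤ 1 / 2) (hδ' : (2 + |c|) * m ^ 2 * |δ| ≤ 1) (hu : 0 < u) (hv : 0 < v) :
    min L (2 * (A / (1 + 2 * (m * |δ|) + 4 * (m * |δ|) ^ 2))
        / (2 + A / (1 + 2 * (m * |δ|) + 4 * (m * |δ|) ^ 2) * (1 / 3 - c + c ^ 2))
        * (1 - (2 + |c|) * m ^ 2 * |δ|) ^ 2) * δ ^ 2
      ≤ 1 / 2 * ratefun u v + A / u * (-(1 / 2) + δ + u / 2 - c * (v - 1)) ^ 2 := by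
  set n := m * |δ| with hn_def
  have hn : 0 ≤ n := by positivity
  have hn2 : n ^ 2 = m ^ 2 * δ ^ 2 := by rw [hn_def, mul_pow, sq_abs]
  set B := A / (1 + 2 * n + 4 * n ^ 2)
  have hB : 0 < B := by positivity
  set X := A / u * (-(1 / 2) + δ + u / 2 - c * (v - 1)) ^ 2 with hX
  have hX0 : 0 ≤ X := by positivity
  set M := min L (2 * B / (2 + B * (1 / 3 - c + c ^ 2)) * (1 - (2 + |c|) * m ^ 2 * |δ|) ^ 2)
    with hM
  suffices h : 2 * (M * δ ^ 2 - X) ≤ ratefun u v by linarith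
  refine le_ratefun hu hv fun g hg hg2 hgu hgv => ?_
  set G := ∫ z in (0:ℝ)..1, g z ^ 2
  rcases le_or_gt G (n ^ 2) with hG | hG
  · obtain ⟨h1, h2⟩ := exp_functional_expansion c hg hg2 hn hδ hG
    rw [hgu] at h1 h2
    rw [hgv] at h2
    have hcs := sq_integral_mul_le zero_le_one (h := fun z => 1 - z - c) (by fun_prop) hg hg2
      (by rw [integral_affine_weight_sq]; exact affine_weight_pos c)
    rw [integral_affine_weight_sq] at hcs
    set s := ∫ z in (0:ℝ)..1, (1 - z - c) * g z
    set e := (u - 1) / 2 - c * (v - 1) - s with he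
    have hBu : B ≤ A / u := by
      have := (abs_le.1 h1).2
      exact div_le_div_of_nonneg_left hA.le hu (by linarith)
    have hq := quadratic_min_le (x := δ + e) (affine_weight_pos c) hB hcs
    have hBX : B * (δ + e + s) ^ 2 ≤ X := by
      have : -(1 / 2) + δ + u / 2 - c * (v - 1) = δ + e + s := by rw [he]; ring
      rw [hX, this]
      exact mul_le_mul_of_nonneg_right hBu (sq_nonneg _)
    have hsq : ((1 - (2 + |c|) * m ^ 2 * |δ|) * |δ|) ^ 2 ≤ (δ + e) ^ 2 := by
      rw [← sq_abs (δ + e)]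
      refine pow_le_pow_left₀ (mul_nonneg (by linarith) (abs_nonneg _)) ?_ 2
      have h3 : |δ| ≤ |δ + e| + |e| := by
        have := abs_sub (δ + e) e
        rwa [add_sub_cancel_right] at this
      rw [hn2, ← sq_abs δ] at h2
      nlinarith
    rw [mul_pow, sq_abs] at hsq
    have hD : 0 ≤ 2 * B / (2 + B * (1 / 3 - c + c ^ 2)) := by
      have := affine_weight_pos c
      positivity
    have hMle := mul_le_mul_of_nonneg_right (min_le_right L
      (2 * B / (2 + B * (1 / 3 - c + c ^ 2)) * (1 - (2 + |c|) * m ^ 2 * |δ|) ^ 2)) (sq_nonneg δ)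
    rw [← hM] at hMle
    have hDsq := mul_le_mul_of_nonneg_left hsq hD
    rw [← mul_assoc] at hDsq
    linarith
  · have hMle := mul_le_mul_of_nonneg_right (min_le_left L
      (2 * B / (2 + B * (1 / 3 - c + c ^ 2)) * (1 - (2 + |c|) * m ^ 2 * |δ|) ^ 2)) (sq_nonneg δ)
    rw [← hM] at hMle
    have hLδ : L * δ ^ 2 = 2 * n ^ 2 := by rw [hL, hn2]; ring
    linarith

lemma rate_functional_upper {A c t m δ : ℝ} (hA : 0 < A) (hm : 0 ≤ m)
    (hmt : m ^ 2 = t ^ 2 * (1 / 3 - c + c ^ 2)) (hδ : m * |δ| ≤ 1 / 2)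
    (hδ' : 0 < 1 - 2 * (m * |δ|) - 4 * (m * |δ|) ^ 2) :
    ∃ u v : ℝ, 0 < u ∧ 0 < v ∧
      1 / 2 * ratefun u v + A / u * (-(1 / 2) + δ + u / 2 - c * (v - 1)) ^ 2
        ≤ (2 * m ^ 2 + A / (1 - 2 * (m * |δ|) - 4 * (m * |δ|) ^ 2)
          * (|1 + t * (1 / 3 - c + c ^ 2)| + (2 + |c|) * m ^ 2 * |δ|) ^ 2) * δ ^ 2 := by
  set n := m * |δ| with hn_def
  have hn : 0 ≤ n := by positivity
  have hn2 : n ^ 2 = m ^ 2 * δ ^ 2 := by rw [hn_def, mul_pow, sq_abs]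
  let g : ℝ → ℝ := fun z => t * δ * (1 - z - c)
  have hg : IntervalIntegrable g volume 0 1 := Continuous.intervalIntegrable (by fun_prop) _ _
  have hg2 : IntervalIntegrable (fun z => g z ^ 2) volume 0 1 :=
    Continuous.intervalIntegrable (by fun_prop) _ _
  have hG : ∫ z in (0:ℝ)..1, g z ^ 2 = n ^ 2 := by
    simp only [g, mul_pow]
    rw [intervalIntegral.integral_const_mul, integral_affine_weight_sq, hn2, hmt]
    ring
  have hs : ∫ z in (0:ℝ)..1, (1 - z - c) * g z = t * δ * (1 / 3 - c + c ^ 2) := by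
    rw [← integral_affine_weight_sq, ← intervalIntegral.integral_const_mul]
    exact intervalIntegral.integral_congr fun z _ => by simp only [g]; ring
  obtain ⟨h1, h2⟩ := exp_functional_expansion c hg hg2 hn hδ hG.le
  have hr := ratefun_le hg hg2
  rw [hG] at hr
  rw [hs] at h2
  set u := ∫ z in (0:ℝ)..1, exp (2 * ∫ t in (0:ℝ)..z, g t)
  set v := exp (∫ t in (0:ℝ)..1, g t)
  have hu' : 1 - 2 * n - 4 * n ^ 2 ≤ u := by linarith [(abs_le.1 h1).1]
  have hu : 0 < u := hδ'.trans_le hu'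
  refine ⟨u, v, hu, exp_pos _, ?_⟩
  set H := 1 / 3 - c + c ^ 2
  set e := (u - 1) / 2 - c * (v - 1) - t * δ * H with he
  have harg : -(1 / 2) + δ + u / 2 - c * (v - 1) = δ * (1 + t * H) + e := by rw [he]; ring
  have habs : |δ * (1 + t * H) + e| ≤ |δ| * (|1 + t * H| + (2 + |c|) * m ^ 2 * |δ|) := by
    refine (abs_add_le _ _).trans ?_
    rw [abs_mul]
    rw [hn2, ← sq_abs δ] at h2
    nlinarith
  have hsq := pow_le_pow_left₀ (abs_nonneg _) habs 2
  rw [sq_abs, mul_pow, sq_abs] at hsq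
  have hAu : A / u ≤ A / (1 - 2 * n - 4 * n ^ 2) :=
    div_le_div_of_nonneg_left hA.le hδ' hu'
  rw [harg]
  have := mul_le_mul hAu hsq (sq_nonneg _) (by positivity)
  rw [hn2] at hr
  nlinarith

/-- Quadratic behavior of the rate function `J_X(y;a,ϱ)` at its minimum `y = −1/2`:
`lim_{y→−1/2} J_X(y;a,ϱ)/(y+1/2)² = 6a/(6 + a − 3√(2a)ϱ)`. -/
theorem ratefun_JX_quadratic (a ϱ : ℝ) (ha : 0 < a) (hϱ : ϱ ∈ Set.Ioo (-1 : ℝ) 1)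
    (JX : ℝ → ℝ)
    (hJX : ∀ y : ℝ, JX y =
      sInf {r : ℝ | ∃ u v : ℝ, 0 < u ∧ 0 < v ∧
        r = (1 / 2) * ratefun u v
          + (a / ((1 - ϱ ^ 2) * u)) * (y + u / 2 - ϱ * Real.sqrt (2 / a) * (v - 1)) ^ 2}) :
    Filter.Tendsto (fun y : ℝ => JX y / (y + 1 / 2) ^ 2)
      (nhdsWithin (-(1 / 2) : ℝ) {y : ℝ | y ≠ -(1 / 2)})
      (nhds (6 * a / (6 + a - 3 * Real.sqrt (2 * a) * ϱ))) := by
  obtain ⟨hϱ1, hϱ2⟩ := hϱ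
  have hρ : 0 < 1 - ϱ ^ 2 := by nlinarith
  set c := ϱ * √(2 / a) with hc
  set A := a / (1 - ϱ ^ 2) with hA_def
  have hA : 0 < A := by positivity
  set H := 1 / 3 - c + c ^ 2 with hH_def
  have hH : 0 < H := affine_weight_pos c
  set L := 2 * A / (2 + A * H) with hL_def
  have hL : 0 < L := by positivity
  have hLval : 6 * a / (6 + a - 3 * √(2 * a) * ϱ) = L := by
    have hsq : √(2 * a) = a * √(2 / a) := by
      rw [show 2 * a = a ^ 2 * (2 / a) by field_simp, sqrt_mul (sq_nonneg a), sqrt_sq ha.le]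
    have hc2 : a * c ^ 2 = 2 * ϱ ^ 2 := by
      rw [hc, mul_pow, sq_sqrt (by positivity)]
      field_simp
    have hden : 6 + a - 3 * √(2 * a) * ϱ = 3 * ((1 - ϱ ^ 2) * (2 + A * H)) := by
      have : (1 - ϱ ^ 2) * (2 + A * H) = 2 * (1 - ϱ ^ 2) + a * H := by
        rw [hA_def]; field_simp
      rw [this, hsq, hH_def]
      linear_combination -3 * hc2 + 3 * a * hc
    rw [hden, hL_def, hA_def]
    field_simp
    ring
  rw [hLval]
  have hJ : ∀ y, JX y = sInf {r : ℝ | ∃ u v : ℝ, 0 < u ∧ 0 < v ∧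
      r = 1 / 2 * ratefun u v + A / u * (y + u / 2 - c * (v - 1)) ^ 2} := by
    intro y
    rw [hJX y]
    simp only [hA_def, div_div]
  obtain ⟨m, hm, hmL⟩ : ∃ m : ℝ, 0 ≤ m ∧ L = 2 * m ^ 2 :=
    ⟨√(L / 2), sqrt_nonneg _, by rw [sq_sqrt (by positivity)]; ring⟩
  set t := -A / (2 + A * H) with ht
  obtain ⟨p, hp, hpt⟩ : ∃ p : ℝ, 0 ≤ p ∧ p ^ 2 = t ^ 2 * H :=
    ⟨√(t ^ 2 * H), sqrt_nonneg _, sq_sqrt (by positivity)⟩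
  let d : ℝ → ℝ := fun y => |y + 1 / 2|
  have hd : ContinuousAt d (-(1 / 2)) := Continuous.continuousAt (by fun_prop)
  have hd0 : d (-(1 / 2)) = 0 := by simp [d]
  have hle : nhdsWithin (-(1 / 2) : ℝ) {y : ℝ | y ≠ -(1 / 2)} ≤ nhds (-(1 / 2)) :=
    nhdsWithin_le_nhds
  have hsmall : ∀ f : ℝ → ℝ, ContinuousAt f 0 → f 0 < 1 / 2 →
      ∀ᶠ y in nhdsWithin (-(1 / 2) : ℝ) {y : ℝ | y ≠ -(1 / 2)}, f (d y) < 1 / 2 := by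
    intro f hf hf0
    have hcomp : ContinuousAt (fun y => f (d y)) (-(1 / 2)) :=
      ContinuousAt.comp (g := f) (by rw [hd0]; exact hf) hd
    exact hle (hcomp.eventually (gt_mem_nhds (by simpa only [hd0] using hf0)))
  let lo : ℝ → ℝ := fun x => min L (2 * (A / (1 + 2 * (m * x) + 4 * (m * x) ^ 2))
        / (2 + A / (1 + 2 * (m * x) + 4 * (m * x) ^ 2) * H)
        * (1 - (2 + |c|) * m ^ 2 * x) ^ 2)
  let hi : ℝ → ℝ := fun x => 2 * p ^ 2 + A / (1 - 2 * (p * x) - 4 * (p * x) ^ 2)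
          * (|1 + t * H| + (2 + |c|) * p ^ 2 * x) ^ 2
  have hB : ContinuousAt (fun x : ℝ => A / (1 + 2 * (m * x) + 4 * (m * x) ^ 2)) 0 :=
    ContinuousAt.div (by fun_prop) (by fun_prop) (by simp)
  have hlo : Tendsto (fun y => lo (d y)) (nhdsWithin (-(1 / 2) : ℝ) {y : ℝ | y ≠ -(1 / 2)})
      (nhds L) := by
    have hcont : ContinuousAt lo 0 := by
      refine continuousAt_const.min (ContinuousAt.mul ?_ (by fun_prop))
      refine ContinuousAt.div (by fun_prop) (by fun_prop) ?_
      simp only [mul_zero, add_zero, ne_eq, OfNat.ofNat_ne_zero, not_false_eq_true, zero_pow,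
        div_one]
      positivity
    have hcomp : ContinuousAt (fun y => lo (d y)) (-(1 / 2)) :=
      ContinuousAt.comp (g := lo) (by rw [hd0]; exact hcont) hd
    have hval : lo (d (-(1 / 2))) = L := by
      rw [hd0]
      simp [lo, hL_def]
    have := hcomp.tendsto.mono_left hle
    rwa [hval] at this
  have hhi : Tendsto (fun y => hi (d y)) (nhdsWithin (-(1 / 2) : ℝ) {y : ℝ | y ≠ -(1 / 2)})
      (nhds L) := by
    have hcont : ContinuousAt hi 0 := by
      refine ContinuousAt.add (by fun_prop) (ContinuousAt.mul ?_ (by fun_prop))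
      exact ContinuousAt.div (by fun_prop) (by fun_prop) (by simp)
    have hcomp : ContinuousAt (fun y => hi (d y)) (-(1 / 2)) :=
      ContinuousAt.comp (g := hi) (by rw [hd0]; exact hcont) hd
    have hval : hi (d (-(1 / 2))) = L := by
      simp only [hi, hd0, mul_zero, add_zero, ne_eq, OfNat.ofNat_ne_zero, not_false_eq_true,
        zero_pow, sub_zero, div_one, sq_abs, hpt]
      rw [ht, hL_def]
      field_simp
      ring
    have := hcomp.tendsto.mono_left hle
    rwa [hval] at this
  refine tendsto_of_tendsto_of_tendsto_of_le_of_le' hlo hhi ?_ ?_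
  · filter_upwards [hsmall (fun x => m * x) (by fun_prop) (by simp),
      hsmall (fun x => (2 + |c|) * m ^ 2 * x) (by fun_prop) (by simp),
      self_mem_nhdsWithin] with y h1 h2 hy
    have hy' : y + 1 / 2 ≠ 0 := fun h => hy (by linarith)
    rw [le_div_iff₀ (by positivity), hJ]
    refine le_csInf ⟨_, 1, 1, one_pos, one_pos, rfl⟩ ?_
    rintro r ⟨u, v, hu, hv, rfl⟩
    have := rate_functional_lower (δ := y + 1 / 2) (c := c) hA hm hmL h1.le (by linarith) hu hv
    rwa [show -(1 / 2) + (y + 1 / 2) = y by ring] at this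
  · filter_upwards [hsmall (fun x => p * x) (by fun_prop) (by simp),
      hsmall (fun x => 2 * (p * x) + 4 * (p * x) ^ 2) (by fun_prop) (by simp),
      self_mem_nhdsWithin] with y h1 h2 hy
    have hy' : y + 1 / 2 ≠ 0 := fun h => hy (by linarith)
    obtain ⟨u, v, hu, hv, h⟩ := rate_functional_upper (δ := y + 1 / 2) (c := c) hA hp hpt h1.le
      (by simp only [d] at h2; linarith)
    rw [show -(1 / 2) + (y + 1 / 2) = y by ring] at h
    rw [div_le_iff₀ (by positivity), hJ]
    refine le_trans (csInf_le ⟨0, ?_⟩ ⟨u, v, hu, hv, rfl⟩) h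
    rintro r ⟨u, v, hu, hv, rfl⟩
    have := ratefun_nonneg u v
    positivity
end
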